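/- Let G be an upper semicontinuous decomposition of ℝⁿ into compact convex sets, with quotient map π : ℝⁿ → ℝⁿ/G, and let σ ⊆ ℝⁿ be a 2-simplex, i.e. σ is the convex hull of an affinely independent set of three points in ℝⁿ. Then the image π(σ) admits a topological embedding into ℝ². -/

import Mathlib

section

open Set Filter Topology

open scoped unitInterval

/-- A continuous isotone function on a compact space with a closed preorder that separates two
points of which the second is not below the first. -/
theorem exists_isotone_separating {P : Type*} [TopologicalSpace P] [CompactSpace P] [T2Space P]
    {le : P → P → Prop} (hcl : IsClosed {q : P × P | le q.1 q.2}) (hrefl : ∀ a, le a a)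
    (htrans : ∀ a b c, le a b → le b c → le a c) {p q : P} (hpq : ¬ le q p) :
    ∃ f : C(P, ℝ), (∀ a, f a ∈ Icc (0 : ℝ) 1) ∧ (∀ a b, le a b → f a ≤ f b) ∧ f p < f q := by
  have hdown : ∀ C : Set P, IsClosed C → IsClosed {x | ∃ c ∈ C, le x c} := by
    intro C hC
    have h := ((hcl.inter (hC.preimage continuous_snd)).isCompact.image continuous_fst).isClosed
    convert h using 1
    ext x
    simp [and_comm]
  have hup : ∀ C : Set P, IsClosed C → IsClosed {x | ∃ c ∈ C, le c x} := by
    intro C hC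
    have h := ((hcl.inter (hC.preimage continuous_fst)).isCompact.image continuous_snd).isClosed
    convert h using 1
    ext x
    simp [and_comm]
  let c : Urysohns.CU (fun _ u : Set P => ∀ a b, le a b → b ∈ u → a ∈ u) :=
    { C := {p}
      U := {z | ¬ le q z}
      P_C_U := fun a b hab hb ha => hb (htrans _ _ _ ha hab)
      closed_C := isClosed_singleton
      open_U := by
        have := hup {q} isClosed_singleton
        simp only [mem_singleton_iff, exists_eq_left] at this
        exact this.isOpen_compl
      subset := by simpa using hpq
      hP := by
        intro C U hC hU hUo hCU
        have hdC : {x | ∃ c ∈ C, le x c} ⊆ U := by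
          rintro x ⟨c, hc, hxc⟩
          exact hU x c hxc (hCU hc)
        obtain ⟨v, hv, hCv, hvU⟩ := normal_exists_closure_subset (hdown C hC) hUo hdC
        have hsub : {x | ∃ c ∈ vᶜ, le c x}ᶜ ⊆ v := by
          intro x hx
          by_contra hxv
          exact hx ⟨x, hxv, hrefl x⟩
        refine ⟨{x | ∃ c ∈ vᶜ, le c x}ᶜ, (hup _ hv.isClosed_compl).isOpen_compl, ?_,
          (closure_mono hsub).trans hvU, ?_, hU⟩
        · rintro x hx ⟨y, hy, hyx⟩
          exact hy (hCv ⟨x, hx, hyx⟩)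
        · rintro a b hab hb ⟨y, hy, hya⟩
          exact hb ⟨y, hy, htrans _ _ _ hya hab⟩ }
  have hmono : ∀ (n : ℕ) (d : Urysohns.CU (fun _ u : Set P => ∀ a b, le a b → b ∈ u → a ∈ u))
      (a b : P), le a b → d.approx n a ≤ d.approx n b := by
    intro n
    induction n with
    | zero =>
      intro d a b hab
      by_cases hb : b ∈ d.U
      · have ha : a ∈ d.U := d.P_C_U a b hab hb
        simp [Urysohns.CU.approx, ha, hb]
      · rw [d.approx_of_notMem_U 0 hb]
        exact d.approx_le_one 0 a
    | succ n ih =>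
      intro d a b hab
      simp only [Urysohns.CU.approx]
      exact midpoint_le_midpoint (ih _ _ _ hab) (ih _ _ _ hab)
  refine ⟨⟨c.lim, c.continuous_lim⟩, c.lim_mem_Icc, ?_, ?_⟩
  · intro a b hab
    exact le_of_tendsto_of_tendsto' (c.tendsto_approx_atTop a) (c.tendsto_approx_atTop b)
      fun n => hmono n c a b hab
  · have h0 : c.lim p = 0 := c.lim_of_mem_C p rfl
    have h1 : c.lim q = 1 := c.lim_of_notMem_U q fun h => h (hrefl q)
    simp [h0, h1]

theorem exists_seq_isotone_separating {P : Type*} [TopologicalSpace P] [CompactSpace P] [T2Space P]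
    [SecondCountableTopology P]
    {le : P → P → Prop} (hcl : IsClosed {q : P × P | le q.1 q.2}) (hrefl : ∀ a, le a a)
    (htrans : ∀ a b c, le a b → le b c → le a c) :
    ∃ f : ℕ → C(P, ℝ), (∀ j a, f j a ∈ Icc (0 : ℝ) 1) ∧ (∀ j a b, le a b → f j a ≤ f j b) ∧
      ∀ p q, ¬ le q p → ∃ j, f j p < f j q := by
  let A : Set C(P, ℝ) := {f | (∀ a, f a ∈ Icc (0 : ℝ) 1) ∧ ∀ a b, le a b → f a ≤ f b}
  have : Nonempty A := ⟨⟨0, by simp, by simp⟩⟩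
  obtain ⟨t, htc, ht⟩ := TopologicalSpace.isOpen_iUnion_countable
    (fun f : A => {q : P × P | f.1 q.1 < f.1 q.2})
    (fun f => isOpen_lt (by fun_prop) (by fun_prop))
  obtain ⟨e, he⟩ := (htc.insert (Classical.arbitrary A)).exists_eq_range (insert_nonempty _ _)
  refine ⟨fun j => (e j).1, fun j => (e j).2.1, fun j => (e j).2.2, fun p q hpq => ?_⟩
  obtain ⟨f, h01, hf, hlt⟩ := exists_isotone_separating hcl hrefl htrans hpq
  have : (p, q) ∈ ⋃ f ∈ t, {q : P × P | (f : A).1 q.1 < f.1 q.2} := by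
    rw [ht]
    exact mem_iUnion.2 ⟨⟨f, h01, hf⟩, hlt⟩
  simp only [mem_iUnion] at this
  obtain ⟨g, hg, hlt⟩ := this
  have : g ∈ range e := he ▸ mem_insert_of_mem _ hg
  obtain ⟨j, rfl⟩ := this
  exact ⟨j, hlt⟩

/-- **Levin's theorem**: a closed preorder on a compact metrizable space has a continuous
utility function. -/
theorem exists_continuous_strictly_isotone {P : Type*} [TopologicalSpace P] [CompactSpace P]
    [T2Space P] [SecondCountableTopology P]
    {le : P → P → Prop} (hcl : IsClosed {q : P × P | le q.1 q.2}) (hrefl : ∀ a, le a a)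
    (htrans : ∀ a b c, le a b → le b c → le a c) :
    ∃ u : C(P, ℝ), (∀ a b, le a b → u a ≤ u b) ∧ ∀ a b, le a b → ¬ le b a → u a < u b := by
  obtain ⟨f, h01, hf, hsep⟩ := exists_seq_isotone_separating hcl hrefl htrans
  have hs : Summable fun j : ℕ => ((1 : ℝ) / 2) ^ j := summable_geometric_two
  have hb : ∀ j a, ‖((1 : ℝ) / 2) ^ j * f j a‖ ≤ (1 / 2) ^ j := by
    intro j a
    rw [Real.norm_of_nonneg (mul_nonneg (by positivity) (h01 j a).1)]
    exact mul_le_of_le_one_right (by positivity) (h01 j a).2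
  have hsum : ∀ a, Summable fun j => ((1 : ℝ) / 2) ^ j * f j a :=
    fun a => Summable.of_norm_bounded hs fun j => hb j a
  refine ⟨⟨fun a => ∑' j, ((1 : ℝ) / 2) ^ j * f j a,
    continuous_tsum (fun j => by fun_prop) hs hb⟩, fun a b hab => ?_, fun a b hab hba => ?_⟩
  · exact (hsum a).tsum_le_tsum (fun j => mul_le_mul_of_nonneg_left (hf j a b hab)
      (by positivity)) (hsum b)
  · obtain ⟨j, hj⟩ := hsep a b hba
    exact (hsum a).tsum_lt_tsum (fun j => mul_le_mul_of_nonneg_left (hf j a b hab)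
      (by positivity)) (mul_lt_mul_of_pos_left hj (by positivity)) (hsum b)

/-- The quotient of a compact metrizable space by a closed equivalence relation is realised
inside a countable product of lines. -/
theorem exists_continuous_kernel_eq {P : Type*} [TopologicalSpace P] [CompactSpace P]
    [T2Space P] [SecondCountableTopology P] (T : Setoid P)
    (hcl : IsClosed {q : P × P | T q.1 q.2}) :
    ∃ f : C(P, ℕ → ℝ), ∀ a b, f a = f b ↔ T a b := by
  obtain ⟨f, -, hf, hsep⟩ := exists_seq_isotone_separating hcl T.refl fun _ _ _ => T.trans
  refine ⟨⟨fun a j => f j a, by fun_prop⟩, fun a b => ⟨fun h => ?_, fun h => ?_⟩⟩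
  · by_contra hab
    obtain ⟨j, hj⟩ := hsep b a hab
    exact hj.ne' (congrFun h j)
  · ext j
    exact le_antisymm (hf j _ _ h) (hf j _ _ (T.symm h))

/-- The classes of an equivalence relation on the unit square are convex. -/
def ConvexClasses (T : Setoid (I × I)) : Prop :=
  ∀ p q r : I × I, T p q → ∀ t : ℝ, 0 ≤ t → t ≤ 1 →
    (r.1 : ℝ) = p.1 + t * (q.1 - p.1) → (r.2 : ℝ) = p.2 + t * (q.2 - p.2) → T p r

theorem exists_between_ratio {a b x : ℝ} (h : (a ≤ x ∧ x ≤ b) ∨ (b ≤ x ∧ x ≤ a)) :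
    ∃ t : ℝ, 0 ≤ t ∧ t ≤ 1 ∧ x = a + t * (b - a) := by
  have hx : x ∈ segment ℝ a b := by
    rw [segment_eq_uIcc, mem_uIcc]
    exact h
  rw [segment_eq_image'] at hx
  obtain ⟨t, ht, rfl⟩ := hx
  exact ⟨t, ht.1, ht.2, rfl⟩

theorem convexComb_mem_unitInterval (a b : I) {t : ℝ} (h0 : 0 ≤ t) (h1 : t ≤ 1) :
    (a + t * (b - a) : ℝ) ∈ I := by
  constructor
  · nlinarith [mul_nonneg h0 b.2.1, mul_nonneg (sub_nonneg.2 h1) a.2.1]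
  · nlinarith [mul_nonneg h0 (sub_nonneg.2 b.2.2),
      mul_nonneg (sub_nonneg.2 h1) (sub_nonneg.2 a.2.2)]

namespace ConvexClasses

variable {T : Setoid (I × I)}

theorem exists_fst_eq (hT : ConvexClasses T) {p q : I × I} (h : T p q) {x : I}
    (hx : (p.1 ≤ x ∧ x ≤ q.1) ∨ (q.1 ≤ x ∧ x ≤ p.1)) : ∃ r : I × I, r.1 = x ∧ T p r := by
  obtain ⟨t, h0, h1, ht⟩ := exists_between_ratio (a := p.1) (b := q.1) (x := x) hx
  exact ⟨(x, ⟨_, convexComb_mem_unitInterval p.2 q.2 h0 h1⟩), rfl, hT p q _ h t h0 h1 ht rfl⟩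

theorem of_snd_between (hT : ConvexClasses T) {p q r : I × I} (h : T p q) (hpq : p.1 = q.1)
    (hpr : p.1 = r.1) (hr : (p.2 ≤ r.2 ∧ r.2 ≤ q.2) ∨ (q.2 ≤ r.2 ∧ r.2 ≤ p.2)) : T p r := by
  obtain ⟨t, h0, h1, ht⟩ := exists_between_ratio (a := p.2) (b := q.2) (x := r.2) hr
  refine hT p q r h t h0 h1 ?_ ht
  rw [← hpq, ← hpr]
  ring

/-- Two classes which cross each other over two vertical lines coincide. -/
theorem of_crossing (hT : ConvexClasses T) {p q p' q' : I × I} (h : T p q) (h' : T p' q')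
    (hp : p.1 = p'.1) (hq : q.1 = q'.1) (hle : p.2 ≤ p'.2) (hge : q'.2 ≤ q.2) : T p p' := by
  have hle' : (p.2 : ℝ) ≤ p'.2 := hle
  have hge' : (q'.2 : ℝ) ≤ q.2 := hge
  obtain ⟨t, h0, h1, ht⟩ := exists_between_ratio (a := (p.2 : ℝ) - p'.2) (b := (q.2 : ℝ) - q'.2)
    (x := 0) (Or.inl ⟨by linarith, by linarith⟩)
  let r : I × I := (⟨_, convexComb_mem_unitInterval p.1 q.1 h0 h1⟩,
    ⟨_, convexComb_mem_unitInterval p.2 q.2 h0 h1⟩)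
  have hr : T p r := hT p q r h t h0 h1 rfl rfl
  have hr' : T p' r := hT p' q' r h' t h0 h1 (by simp [r, hp, hq]) (by simp [r]; linarith)
  exact T.trans hr (T.symm hr')

end ConvexClasses

/-- The vertical order: on each vertical line the usual order, blurred by `T`. -/
def VertLE (T : Setoid (I × I)) (p q : I × I) : Prop :=
  p.1 = q.1 ∧ (p.2 ≤ q.2 ∨ T p q)

/-- Some point equivalent to `a` lies vertically below some point equivalent to `b`. -/
def ClassLE (T : Setoid (I × I)) (a b : I × I) : Prop :=
  ∃ a' b', T a a' ∧ T b b' ∧ VertLE T a' b'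

section

variable {T : Setoid (I × I)}

theorem VertLE.refl (p : I × I) : VertLE T p p := ⟨rfl, Or.inl le_rfl⟩

theorem VertLE.total {p q : I × I} (h : p.1 = q.1) : VertLE T p q ∨ VertLE T q p := by
  rcases le_total p.2 q.2 with h' | h'
  · exact Or.inl ⟨h, Or.inl h'⟩
  · exact Or.inr ⟨h.symm, Or.inl h'⟩

theorem VertLE.trans (hT : ConvexClasses T) {p q r : I × I} (hpq : VertLE T p q)
    (hqr : VertLE T q r) : VertLE T p r := by
  obtain ⟨h1, h2⟩ := hpq
  obtain ⟨h3, h4⟩ := hqr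
  refine ⟨h1.trans h3, ?_⟩
  by_cases hpr : p.2 ≤ r.2
  · exact Or.inl hpr
  · have hrp := (not_le.1 hpr).le
    rcases h2 with h2 | h2 <;> rcases h4 with h4 | h4
    · exact Or.inl (h2.trans h4)
    · exact Or.inr (T.symm (hT.of_snd_between (T.symm h4) h3.symm (h1.trans h3).symm
        (Or.inl ⟨hrp, h2⟩)))
    · exact Or.inr (hT.of_snd_between h2 h1 (h1.trans h3) (Or.inr ⟨h4, hrp⟩))
    · exact Or.inr (T.trans h2 h4)

theorem VertLE.isClosed (hcl : IsClosed {q : (I × I) × (I × I) | T q.1 q.2}) :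
    IsClosed {q : (I × I) × (I × I) | VertLE T q.1 q.2} :=
  (isClosed_eq (by fun_prop) (by fun_prop)).inter
    ((isClosed_le (by fun_prop) (by fun_prop)).union hcl)

theorem VertLE.classLE {p q : I × I} (h : VertLE T p q) : ClassLE T p q :=
  ⟨p, q, T.refl p, T.refl q, h⟩

theorem ClassLE.of_rel {p q : I × I} (h : T p q) : ClassLE T p q :=
  ⟨q, q, h, T.refl q, VertLE.refl q⟩

theorem ClassLE.antisymm (hT : ConvexClasses T) {a b : I × I} (hab : ClassLE T a b)
    (hba : ClassLE T b a) : T a b := by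
  obtain ⟨a', b', ha', hb', h1, h2⟩ := hab
  obtain ⟨b'', a'', hb'', ha'', h3, h4⟩ := hba
  rcases h2 with h2 | h2
  · rcases h4 with h4 | h4
    · exact T.trans ha' (T.trans (hT.of_crossing (T.trans (T.symm ha') ha'')
        (T.trans (T.symm hb') hb'') h1 h3.symm h2 h4) (T.symm hb'))
    · exact T.trans ha'' (T.trans (T.symm h4) (T.symm hb''))
  · exact T.trans ha' (T.trans h2 (T.symm hb'))

theorem ClassLE.vertLE (hT : ConvexClasses T) {a b p q : I × I} (hab : ClassLE T a b)
    (hp : T a p) (hq : T b q) (h : p.1 = q.1) : VertLE T p q := by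
  rcases VertLE.total (T := T) h with h' | h'
  · exact h'
  · have := hab.antisymm hT ⟨q, p, hq, hp, h'⟩
    exact ⟨h, Or.inr (T.trans (T.symm hp) (T.trans this hq))⟩

theorem exists_rightmost (hcl : IsClosed {q : (I × I) × (I × I) | T q.1 q.2}) (a : I × I) :
    ∃ b, T a b ∧ ∀ r, T a r → r.1 ≤ b.1 := by
  have hc : IsCompact {r | T a r} :=
    (hcl.preimage (by fun_prop : Continuous fun r => (a, r))).isCompact
  obtain ⟨b, hb, hmax⟩ := hc.exists_isMaxOn ⟨a, T.refl a⟩ continuous_fst.continuousOn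
  exact ⟨b, hb, fun r hr => hmax hr⟩

/-- There are no nontrivial cycles of classes for the relation `ClassLE`. -/
theorem ClassLE.cycle (hT : ConvexClasses T) (hcl : IsClosed {q : (I × I) × (I × I) | T q.1 q.2})
    (m : ℕ) : ∀ c : ℕ → I × I, (∀ i < m, ClassLE T (c i) (c (i + 1))) → ClassLE T (c m) (c 0) →
      ∀ i ≤ m, T (c 0) (c i) := by
  induction m with
  | zero =>
    intro c _ _ i hi
    rw [Nat.le_zero.1 hi]
  | succ m ih =>
    intro c hc hlast
    have hmod : ∀ i, ClassLE T (c (i % (m + 2))) (c ((i + 1) % (m + 2))) := by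
      intro i
      have hlt : i % (m + 2) < m + 2 := Nat.mod_lt _ (by omega)
      rcases Nat.lt_or_ge (i % (m + 2)) (m + 1) with h | h
      · have : (i + 1) % (m + 2) = i % (m + 2) + 1 := by
          rw [Nat.add_mod, Nat.mod_eq_of_lt (a := 1) (by omega), Nat.mod_eq_of_lt (by omega)]
        rw [this]
        exact hc _ h
      · have h' : i % (m + 2) = m + 1 := by omega
        have : (i + 1) % (m + 2) = 0 := by
          rw [Nat.add_mod, h', Nat.mod_eq_of_lt (a := 1) (by omega), Nat.mod_self]
        rw [this, h']
        exact hlast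
    choose b hb hmax using exists_rightmost hcl
    obtain ⟨i₀, hi₀', hi₀⟩ := Finset.exists_min_image (Finset.range (m + 2)) (fun i => (b (c i)).1)
      ⟨0, by simp⟩
    set d : ℕ → I × I := fun i => c ((i + i₀) % (m + 2)) with hd
    have hdR : ∀ i, ClassLE T (d i) (d (i + 1)) := by
      intro i
      have := hmod (i + i₀)
      rwa [add_right_comm] at this
    have hdmin : ∀ i, (b (d 0)).1 ≤ (b (d i)).1 := by
      intro i
      have h0 : (b (d 0)).1 ≤ (b (c i₀)).1 := by
        simp [hd, Nat.mod_eq_of_lt (Finset.mem_range.1 hi₀')]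
      exact h0.trans (hi₀ _ (Finset.mem_range.2 (Nat.mod_lt _ (by omega))))
    have hd0 : d (m + 2) = d 0 := by simp [hd]
    obtain ⟨z, w, hz, hw, hzw⟩ := hdR 0
    obtain ⟨w', z', hw', hz', hwz'⟩ := hdR (m + 1)
    rw [show m + 1 + 1 = m + 2 from rfl, hd0] at hz'
    have hq : ∃ q, q.1 = (b (d 0)).1 ∧ T (d 1) q := by
      obtain ⟨q, hq, hq'⟩ := hT.exists_fst_eq (x := (b (d 0)).1) (T.trans (T.symm hw) (hb (d 1)))
        (Or.inl ⟨hzw.1 ▸ hmax _ _ hz, hdmin 1⟩)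
      exact ⟨q, hq, T.trans hw hq'⟩
    have hp : ∃ q, q.1 = (b (d 0)).1 ∧ T (d (m + 1)) q := by
      obtain ⟨q, hq, hq'⟩ := hT.exists_fst_eq (x := (b (d 0)).1)
        (T.trans (T.symm hw') (hb (d (m + 1))))
        (Or.inl ⟨hwz'.1 ▸ hmax _ _ hz', hdmin (m + 1)⟩)
      exact ⟨q, hq, T.trans hw' hq'⟩
    obtain ⟨q, hq1, hq2⟩ := hq
    obtain ⟨p, hp1, hp2⟩ := hp
    have hlast' : ClassLE T (d (m + 1)) (d 0) := by
      have := hdR (m + 1)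
      rwa [show m + 1 + 1 = m + 2 from rfl, hd0] at this
    have hpz := hlast'.vertLE hT hp2 (hb (d 0)) hp1
    have hzq := (hdR 0).vertLE hT (hb (d 0)) hq2 hq1.symm
    have hskip : ClassLE T (d (m + 1)) (d 1) := ⟨p, q, hp2, hq2, hpz.trans hT hzq⟩
    have hIH := ih (fun i => d (i + 1)) (fun i _ => hdR (i + 1)) hskip
    have h01 : T (d 0) (d 1) := by
      refine (hdR 0).antisymm hT ?_
      obtain ⟨s, t, hs, ht, hst⟩ := hlast'
      exact ⟨s, t, T.trans (hIH m le_rfl) hs, ht, hst⟩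
    have hall : ∀ i ≤ m + 1, T (d 0) (d i) := by
      intro i hi
      rcases i with _ | i
      · exact T.refl _
      · exact T.trans h01 (hIH i (by omega))
    have hall' : ∀ i ≤ m + 1, T (d 0) (c i) := by
      intro i hi
      have := hall ((i + (m + 2) * i₀ - i₀) % (m + 2)) (Nat.le_of_lt_succ (Nat.mod_lt _ (by omega)))
      have hdi : d ((i + (m + 2) * i₀ - i₀) % (m + 2)) = c i := by
        simp only [hd, Nat.mod_add_mod]
        rw [show i + (m + 2) * i₀ - i₀ + i₀ = i + (m + 2) * i₀ by
          have : i₀ ≤ (m + 2) * i₀ := Nat.le_mul_of_pos_left _ (by omega)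
          omega, Nat.add_mul_mod_self_left, Nat.mod_eq_of_lt (by omega)]
      rwa [hdi] at this
    intro i hi
    exact T.trans (T.symm (hall' 0 (by omega))) (hall' i hi)

theorem exists_chain_of_reflTransGen {α : Type*} {R : α → α → Prop} {p q : α}
    (h : Relation.ReflTransGen R p q) :
    ∃ (m : ℕ) (c : ℕ → α), c 0 = p ∧ c m = q ∧ ∀ i < m, R (c i) (c (i + 1)) := by
  induction h with
  | refl => exact ⟨0, fun _ => p, rfl, rfl, by simp⟩
  | @tail b d _ hbd ih =>
    obtain ⟨m, c, h0, hm, hc⟩ := ih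
    refine ⟨m + 1, fun i => if i ≤ m then c i else d, by simp [h0], by simp, ?_⟩
    intro i hi
    rcases Nat.lt_or_ge i m with h | h
    · simpa [h.le, Nat.succ_le_of_lt h] using hc i h
    · have : i = m := by omega
      subst this
      simpa [hm] using hbd

theorem vertLE_of_reflTransGen (hT : ConvexClasses T)
    (hcl : IsClosed {q : (I × I) × (I × I) | T q.1 q.2}) {p q : I × I}
    (h : Relation.ReflTransGen (fun a b => VertLE T a b ∨ T a b) p q) (hpq : p.1 = q.1) :
    VertLE T p q := by
  rcases VertLE.total (T := T) hpq with h' | h'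
  · exact h'
  · obtain ⟨m, c, h0, hm, hc⟩ := exists_chain_of_reflTransGen h
    refine ⟨hpq, Or.inr ?_⟩
    rw [← h0, ← hm]
    refine ClassLE.cycle hT hcl m c (fun i hi => ?_) ?_ m le_rfl
    · rcases hc i hi with h | h
      · exact h.classLE
      · exact ClassLE.of_rel h
    · rw [h0, hm]
      exact h'.classLE

theorem isClosed_relComp {P : Type*} [TopologicalSpace P] [CompactSpace P] [T2Space P]
    {A B : P → P → Prop} (hA : IsClosed {q : P × P | A q.1 q.2})
    (hB : IsClosed {q : P × P | B q.1 q.2}) :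
    IsClosed {q : P × P | Relation.Comp A B q.1 q.2} := by
  have h : IsClosed {q : (P × P) × P | A q.1.1 q.2 ∧ B q.2 q.1.2} :=
    (hA.preimage (by fun_prop : Continuous fun q : (P × P) × P => (q.1.1, q.2))).inter
      (hB.preimage (by fun_prop : Continuous fun q : (P × P) × P => (q.2, q.1.2)))
  have h' := (h.isCompact.image continuous_fst).isClosed
  convert h' using 1
  ext q
  simp [Relation.Comp]

/-- Equivalent points whose class meets the vertical line over `c`. -/
def LineRel (T : Setoid (I × I)) (c : I) (p q : I × I) : Prop :=
  T p q ∧ ∃ z : I × I, z.1 = c ∧ T p z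

/-- The preorder generated by the vertical order and the identification of all points of the
classes meeting one of the lines over `F`. -/
def SweepLE (T : Setoid (I × I)) (F : Finset I) : I × I → I × I → Prop :=
  Relation.ReflTransGen fun p q => VertLE T p q ∨ ∃ c ∈ F, LineRel T c p q

theorem LineRel.isClosed (hcl : IsClosed {q : (I × I) × (I × I) | T q.1 q.2}) (c : I) :
    IsClosed {q : (I × I) × (I × I) | LineRel T c q.1 q.2} := by
  have h1 : IsClosed {q : ((I × I) × (I × I)) | T q.1 q.2 ∧ q.2.1 = c} :=
    hcl.inter (isClosed_eq (by fun_prop) (by fun_prop))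
  have h2 := (h1.isCompact.image continuous_fst).isClosed.preimage
    (continuous_fst (X := I × I) (Y := I × I))
  convert hcl.inter h2 using 1
  ext q
  simp [LineRel, and_comm]

theorem SweepLE.reflTransGen {F : Finset I} {p q : I × I} (h : SweepLE T F p q) :
    Relation.ReflTransGen (fun a b => VertLE T a b ∨ T a b) p q := by
  refine Relation.ReflTransGen.mono ?_ _ _ h
  rintro a b (h | ⟨c, -, h, -⟩)
  · exact Or.inl h
  · exact Or.inr h

theorem SweepLE.mono {F G : Finset I} (hFG : F ⊆ G) {p q : I × I} (h : SweepLE T F p q) :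
    SweepLE T G p q := by
  refine Relation.ReflTransGen.mono ?_ _ _ h
  rintro a b (h | ⟨c, hc, h⟩)
  · exact Or.inl h
  · exact Or.inr ⟨c, hFG hc, h⟩

theorem sweepLE_insert_iff [DecidableEq I] (hT : ConvexClasses T)
    (hcl : IsClosed {q : (I × I) × (I × I) | T q.1 q.2}) {c : I} {F : Finset I} {p q : I × I} :
    SweepLE T (insert c F) p q ↔ SweepLE T F p q ∨
      Relation.Comp (Relation.Comp (Relation.Comp (Relation.Comp (SweepLE T F) (LineRel T c))
        (VertLE T)) (LineRel T c)) (SweepLE T F) p q := by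
  constructor
  · intro h
    induction h with
    | refl => exact Or.inl .refl
    | @tail q r hpq hqr ih =>
      have hstep : (VertLE T q r ∨ ∃ c ∈ F, LineRel T c q r) ∨ LineRel T c q r := by
        rcases hqr with h | ⟨d, hd, h⟩
        · exact Or.inl (Or.inl h)
        · rcases Finset.mem_insert.1 hd with rfl | hd
          · exact Or.inr h
          · exact Or.inl (Or.inr ⟨d, hd, h⟩)
      rcases hstep with hstep | ⟨hqr, z, hz, hqz⟩
      · rcases ih with ih | ⟨e, he, ih⟩
        · exact Or.inl (ih.tail hstep)
        · exact Or.inr ⟨e, he, ih.tail hstep⟩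
      · rcases ih with ih | ⟨e, ⟨d, ⟨b, ⟨a, hpa, hab, y, hy, hay⟩, hbd⟩, hde, -⟩, heq⟩
        · exact Or.inr ⟨r, ⟨z, ⟨z, ⟨q, ih, hqz, z, hz, hqz⟩, VertLE.refl z⟩,
            T.trans (T.symm hqz) hqr, z, hz, T.refl z⟩, .refl⟩
        · have hyz : VertLE T y z := by
            refine vertLE_of_reflTransGen hT hcl ?_ (hy.trans hz.symm)
            refine .trans (.trans (.trans (.trans ?_ (.single (Or.inl hbd))) ?_)
              heq.reflTransGen) ?_
            · exact .single (Or.inr (T.trans (T.symm hay) hab))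
            · exact .single (Or.inr hde)
            · exact .single (Or.inr hqz)
          exact Or.inr ⟨r, ⟨z, ⟨y, ⟨a, hpa, hay, y, hy, hay⟩, hyz⟩,
            T.trans (T.symm hqz) hqr, z, hz, T.refl z⟩, .refl⟩
  · have hline : ∀ {a b}, LineRel T c a b → SweepLE T (insert c F) a b := fun h =>
      .single (Or.inr ⟨c, Finset.mem_insert_self _ _, h⟩)
    have hF : ∀ {a b}, SweepLE T F a b → SweepLE T (insert c F) a b :=
      fun h => h.mono (Finset.subset_insert _ _)
    rintro (h | ⟨e, ⟨d, ⟨b, ⟨a, hpa, hab⟩, hbd⟩, hde⟩, heq⟩)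
    · exact hF h
    · exact .trans (.trans (.trans (.trans (hF hpa) (hline hab)) (.single (Or.inl hbd)))
        (hline hde)) (hF heq)

theorem SweepLE.isClosed (hT : ConvexClasses T)
    (hcl : IsClosed {q : (I × I) × (I × I) | T q.1 q.2}) (F : Finset I) :
    IsClosed {q : (I × I) × (I × I) | SweepLE T F q.1 q.2} := by
  classical
  induction F using Finset.induction_on with
  | empty =>
    have : SweepLE T ∅ = VertLE T := by
      ext p q
      constructor
      · intro h
        induction h with
        | refl => exact VertLE.refl p
        | tail _ h ih => exact ih.trans hT (by simpa using h)
      · exact fun h => .single (Or.inl h)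
    rw [this]
    exact VertLE.isClosed hcl
  | insert c F _ ih =>
    simp only [sweepLE_insert_iff hT hcl]
    exact ih.union (isClosed_relComp (isClosed_relComp (isClosed_relComp (isClosed_relComp ih
      (LineRel.isClosed hcl c)) (VertLE.isClosed hcl)) (LineRel.isClosed hcl c)) ih)

end

/-- A map on the unit square which identifies only convex sets, and no boundary point with any
other point. -/
structure ConvexFibers {X : Type*} [TopologicalSpace X] (π : C(I × I, X)) : Prop where
  convex : ConvexClasses (Setoid.ker π)
  eq_of_boundary : ∀ p q, π p = π q → (p.1 = 0 ∨ p.1 = 1 ∨ p.2 = 0 ∨ p.2 = 1) → p = q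

/-- The fibers of `π`, with the bottom edge and the top edge collapsed. -/
def collapseEdges {X : Type*} [TopologicalSpace X] {π : C(I × I, X)} (hπ : ConvexFibers π) :
    Setoid (I × I) where
  r p q := π p = π q ∨ (p.2 = 0 ∧ q.2 = 0) ∨ (p.2 = 1 ∧ q.2 = 1)
  iseqv :=
    { refl := fun p => Or.inl rfl
      symm := by
        rintro p q (h | h | h)
        · exact Or.inl h.symm
        · exact Or.inr (Or.inl h.symm)
        · exact Or.inr (Or.inr h.symm)
      trans := by
        rintro p q r (h | h | h) (h' | h' | h')
        · exact Or.inl (h.trans h')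
        · obtain rfl := hπ.eq_of_boundary q p h.symm (by simp [h'])
          exact Or.inr (Or.inl h')
        · obtain rfl := hπ.eq_of_boundary q p h.symm (by simp [h'])
          exact Or.inr (Or.inr h')
        · obtain rfl := hπ.eq_of_boundary q r h' (by simp [h])
          exact Or.inr (Or.inl h)
        · exact Or.inr (Or.inl ⟨h.1, h'.2⟩)
        · exact absurd (h.2.symm.trans h'.1) zero_ne_one
        · obtain rfl := hπ.eq_of_boundary q r h' (by simp [h])
          exact Or.inr (Or.inr h)
        · exact absurd (h'.1.symm.trans h.2) zero_ne_one
        · exact Or.inr (Or.inr ⟨h.1, h'.2⟩) }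

theorem convexClasses_collapseEdges {X : Type*} [TopologicalSpace X] {π : C(I × I, X)}
    (hπ : ConvexFibers π) : ConvexClasses (collapseEdges hπ) := by
  rintro p q r (h | ⟨h, h'⟩ | ⟨h, h'⟩) t h0 h1 hr1 hr2
  · exact Or.inl (hπ.convex p q r h t h0 h1 hr1 hr2)
  · refine Or.inr (Or.inl ⟨h, Subtype.ext ?_⟩)
    rw [hr2, h, h']
    simp
  · refine Or.inr (Or.inr ⟨h, Subtype.ext ?_⟩)
    rw [hr2, h, h']
    simp

theorem isClosed_collapseEdges {X : Type*} [TopologicalSpace X] [T2Space X] {π : C(I × I, X)}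
    (hπ : ConvexFibers π) :
    IsClosed {q : (I × I) × (I × I) | collapseEdges hπ q.1 q.2} :=
  (isClosed_eq (by fun_prop) (by fun_prop)).union
    (((isClosed_eq (by fun_prop) (by fun_prop)).inter
      (isClosed_eq (by fun_prop) (by fun_prop))).union
      ((isClosed_eq (by fun_prop) (by fun_prop)).inter
      (isClosed_eq (by fun_prop) (by fun_prop))))

/-- A new vertical coordinate `w` on the square: it is monotone on vertical lines, where it
identifies exactly the points with the same image, and it is constant on the fibers which meet
one of finitely many given vertical lines. -/
structure IsVerticalCoordinate {X : Type*} [TopologicalSpace X] (π : C(I × I, X)) (F : Finset I)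
    (w : C(I × I, I)) : Prop where
  zero : ∀ x, w (x, 0) = 0
  one : ∀ x, w (x, 1) = 1
  eq_of_eq : ∀ p q, p.1 = q.1 → w p = w q → π p = π q
  eq_of_fst : ∀ p q, π p = π q → p.1 = q.1 → w p = w q
  eq_of_mem : ∀ p q z, π p = π q → π p = π z → z.1 ∈ F → w p = w q

theorem exists_isVerticalCoordinate {X : Type*} [TopologicalSpace X] [T2Space X]
    {π : C(I × I, X)} (hπ : ConvexFibers π) (F : Finset I) :
    ∃ w : C(I × I, I), IsVerticalCoordinate π F w := by
  classical
  set T := collapseEdges hπ with hTdef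
  have hT : ConvexClasses T := convexClasses_collapseEdges hπ
  have hcl : IsClosed {q : (I × I) × (I × I) | T q.1 q.2} := isClosed_collapseEdges hπ
  obtain ⟨u, humono, hustrict⟩ := exists_continuous_strictly_isotone
    (SweepLE.isClosed hT hcl (insert 0 F)) (fun _ => Relation.ReflTransGen.refl)
    (fun _ _ _ => Relation.ReflTransGen.trans)
  have hvert : ∀ p q, VertLE T p q → u p ≤ u q := fun p q h => humono p q (.single (Or.inl h))
  have hline : ∀ p q z, T p q → T p z → z.1 ∈ insert 0 F → u p = u q := by
    intro p q z hpq hpz hz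
    refine le_antisymm (humono p q (.single (Or.inr ⟨z.1, hz, hpq, z, rfl, hpz⟩)))
      (humono q p (.single (Or.inr ⟨z.1, hz, T.symm hpq, z, rfl, T.trans (T.symm hpq) hpz⟩)))
  have hbot : ∀ x, u (x, 0) = u (0, 0) := fun x =>
    hline _ _ (0, 0) (Or.inr (Or.inl ⟨rfl, rfl⟩)) (Or.inr (Or.inl ⟨rfl, rfl⟩)) (by simp)
  have htop : ∀ x, u (x, 1) = u (0, 1) := fun x =>
    hline _ _ (0, 1) (Or.inr (Or.inr ⟨rfl, rfl⟩)) (Or.inr (Or.inr ⟨rfl, rfl⟩)) (by simp)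
  have hback : ∀ p q : I × I, p.1 = q.1 → u p = u q → π p = π q := by
    have key : ∀ p q : I × I, p.1 = q.1 → p.2 ≤ q.2 → u p = u q → π p = π q := by
      intro p q h1 h2 hu
      have hqp : SweepLE T (insert 0 F) q p := by
        by_contra hn
        exact (hustrict p q (.single (Or.inl ⟨h1, Or.inl h2⟩)) hn).ne hu
      obtain ⟨-, h | h⟩ := vertLE_of_reflTransGen hT hcl hqp.reflTransGen h1.symm
      · rw [Prod.ext h1 (le_antisymm h2 h)]
      · rcases h with h | h | h
        · exact h.symm
        · rw [Prod.ext h1 (h.2.trans h.1.symm)]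
        · rw [Prod.ext h1 (h.2.trans h.1.symm)]
    intro p q h1 hu
    rcases le_total p.2 q.2 with h | h
    · exact key p q h1 h hu
    · exact (key q p h1.symm h hu.symm).symm
  have hlt : u (0, 0) < u (0, 1) := by
    refine lt_of_le_of_ne (hvert _ _ ⟨rfl, Or.inl zero_le_one⟩) fun h => ?_
    have := hπ.eq_of_boundary _ _ (hback (0, 0) (0, 1) rfl h) (by simp)
    simp at this
  have hpos := sub_pos.2 hlt
  have h0 : ∀ p, 0 ≤ (u p - u (0, 0)) / (u (0, 1) - u (0, 0)) := by
    intro p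
    refine div_nonneg (sub_nonneg.2 ?_) hpos.le
    rw [← hbot p.1]
    exact hvert _ _ ⟨rfl, Or.inl p.2.2.1⟩
  have h1 : ∀ p, (u p - u (0, 0)) / (u (0, 1) - u (0, 0)) ≤ 1 := by
    intro p
    refine (div_le_one hpos).2 (sub_le_sub_right ?_ _)
    rw [← htop p.1]
    exact hvert _ _ ⟨rfl, Or.inl p.2.2.2⟩
  have hw : ∀ p q, u p = u q → (⟨_, h0 p, h1 p⟩ : I) = ⟨_, h0 q, h1 q⟩ := by
    intro p q h
    simp [h]
  refine ⟨⟨fun p => ⟨_, h0 p, h1 p⟩, by fun_prop⟩, ?_, ?_, ?_, ?_, ?_⟩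
  · intro x
    apply Subtype.ext
    simp [hbot x]
  · intro x
    apply Subtype.ext
    simp [htop x, hpos.ne']
  · intro p q h h'
    refine hback p q h ?_
    have := congrArg Subtype.val h'
    simpa [div_left_inj' hpos.ne'] using this
  · intro p q h h'
    exact hw p q (le_antisymm (hvert _ _ ⟨h', Or.inr (Or.inl h)⟩)
      (hvert _ _ ⟨h'.symm, Or.inr (Or.inl h.symm)⟩))
  · intro p q z h h' hz
    exact hw p q (hline p q z (Or.inl h) (Or.inl h') (Finset.mem_insert_of_mem hz))

namespace IsVerticalCoordinate

variable {X : Type*} [TopologicalSpace X] {π : C(I × I, X)} {F : Finset I} {w : C(I × I, I)}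

/-- The map of the square collapsing the vertical pieces of the fibers. -/
def collapse (w : C(I × I, I)) : C(I × I, I × I) := ⟨fun p => (p.1, w p), by fun_prop⟩

@[simp] theorem collapse_apply (w : C(I × I, I)) (p : I × I) : collapse w p = (p.1, w p) := rfl

theorem collapse_surjective (h : IsVerticalCoordinate π F w) :
    Function.Surjective (collapse w) := by
  intro p
  obtain ⟨y, hy⟩ := mem_range_of_exists_le_of_exists_ge (f := fun y => w (p.1, y)) (c := p.2)
    (by fun_prop) ⟨0, by simp [h.zero]⟩ ⟨1, by simp [h.one, unitInterval.le_one']⟩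
  exact ⟨(p.1, y), Prod.ext rfl hy⟩

theorem isQuotientMap (h : IsVerticalCoordinate π F w) : IsQuotientMap (collapse w) :=
  (collapse w).continuous.isClosedMap.isQuotientMap (collapse w).continuous h.collapse_surjective

theorem collapse_eq_iff (h : IsVerticalCoordinate π F w) {p q : I × I} :
    collapse w p = collapse w q ↔ p.1 = q.1 ∧ π p = π q := by
  simp only [collapse_apply, Prod.mk.injEq]
  exact ⟨fun h' => ⟨h'.1, h.eq_of_eq p q h'.1 h'.2⟩, fun h' => ⟨h'.1, h.eq_of_fst p q h'.2 h'.1⟩⟩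

/-- The map induced by `π` in the new coordinates. -/
noncomputable def desc (h : IsVerticalCoordinate π F w) : C(I × I, X) :=
  h.isQuotientMap.lift π fun _ _ hpq => (h.collapse_eq_iff.1 hpq).2

theorem desc_apply (h : IsVerticalCoordinate π F w) (p : I × I) : h.desc (p.1, w p) = π p :=
  congrArg (fun f : C(I × I, X) => f p)
    (h.isQuotientMap.lift_comp π fun _ _ hpq => (h.collapse_eq_iff.1 hpq).2)

theorem exists_homeomorph {F' : Finset I} {w' : C(I × I, I)} (h : IsVerticalCoordinate π F w)
    (h' : IsVerticalCoordinate π F' w') :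
    ∃ θ : (I × I) ≃ₜ (I × I), (∀ p, (θ p).1 = p.1) ∧ ∀ p, h'.desc (θ p) = h.desc p := by
  have hfac : Function.FactorsThrough (collapse w') (collapse w) :=
    fun p q hpq => h'.collapse_eq_iff.2 (h.collapse_eq_iff.1 hpq)
  let f : C(I × I, I × I) := h.isQuotientMap.lift (collapse w') hfac
  have hf : ∀ p, f (p.1, w p) = (p.1, w' p) := fun p =>
    congrArg (fun f : C(I × I, I × I) => f p) (h.isQuotientMap.lift_comp (collapse w') hfac)
  have hbij : Function.Bijective f := by
    constructor
    · intro a b hab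
      obtain ⟨p, rfl⟩ := h.collapse_surjective a
      obtain ⟨q, rfl⟩ := h.collapse_surjective b
      simp only [collapse_apply, hf] at hab
      exact h.collapse_eq_iff.2 (h'.collapse_eq_iff.1 hab)
    · intro b
      obtain ⟨q, rfl⟩ := h'.collapse_surjective b
      exact ⟨_, hf q⟩
  refine ⟨Continuous.homeoOfEquivCompactToT2 (f := Equiv.ofBijective f hbij) f.continuous, ?_, ?_⟩
  · intro a
    obtain ⟨p, rfl⟩ := h.collapse_surjective a
    change (f (p.1, w p)).1 = p.1
    rw [hf]
  · intro a
    obtain ⟨p, rfl⟩ := h.collapse_surjective a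
    change h'.desc (f (p.1, w p)) = h.desc (p.1, w p)
    rw [hf, desc_apply, desc_apply]

theorem range_desc (h : IsVerticalCoordinate π F w) : range h.desc = range π := by
  apply subset_antisymm
  · rintro _ ⟨a, rfl⟩
    obtain ⟨p, rfl⟩ := h.collapse_surjective a
    exact ⟨p, (h.desc_apply p).symm⟩
  · rintro _ ⟨p, rfl⟩
    exact ⟨_, h.desc_apply p⟩

theorem desc_eq_of_fst (h : IsVerticalCoordinate π F w) {a b : I × I}
    (hab : h.desc a = h.desc b) (h1 : a.1 = b.1) : a = b := by
  obtain ⟨p, rfl⟩ := h.collapse_surjective a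
  obtain ⟨q, rfl⟩ := h.collapse_surjective b
  simp only [collapse_apply, desc_apply] at hab h1
  exact h.collapse_eq_iff.2 ⟨h1, hab⟩

theorem desc_eq_of_side (hπ : ConvexFibers π) (h : IsVerticalCoordinate π F w) {a b : I × I}
    (hab : h.desc a = h.desc b) (h1 : a.1 = 0 ∨ a.1 = 1) : a = b := by
  obtain ⟨p, rfl⟩ := h.collapse_surjective a
  obtain ⟨q, rfl⟩ := h.collapse_surjective b
  simp only [collapse_apply, desc_apply] at hab h1
  rw [hπ.eq_of_boundary p q hab (by tauto)]

theorem exists_desc_eq (hπ : ConvexFibers π) (h : IsVerticalCoordinate π F w) {a b : I × I}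
    (hab : h.desc a = h.desc b) {x : I} (hx : (a.1 ≤ x ∧ x ≤ b.1) ∨ (b.1 ≤ x ∧ x ≤ a.1)) :
    ∃ y, h.desc a = h.desc (x, y) := by
  obtain ⟨p, rfl⟩ := h.collapse_surjective a
  obtain ⟨q, rfl⟩ := h.collapse_surjective b
  simp only [collapse_apply, desc_apply] at hab hx ⊢
  obtain ⟨r, rfl, hr'⟩ := hπ.convex.exists_fst_eq (T := Setoid.ker π) (p := p) (q := q) hab hx
  exact ⟨w r, by rw [h.desc_apply]; exact hr'⟩

theorem desc_horizontal (hπ : ConvexFibers π) (h : IsVerticalCoordinate π F w) {a b c : I × I}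
    (hab : h.desc a = h.desc b) (hac : h.desc a = h.desc c) (hc : c.1 ∈ F) :
    a.2 = b.2 ∧ ∀ x, (a.1 ≤ x ∧ x ≤ b.1) ∨ (b.1 ≤ x ∧ x ≤ a.1) →
      h.desc (x, a.2) = h.desc a := by
  obtain ⟨p, rfl⟩ := h.collapse_surjective a
  obtain ⟨q, rfl⟩ := h.collapse_surjective b
  obtain ⟨z, rfl⟩ := h.collapse_surjective c
  simp only [collapse_apply, desc_apply] at hab hac hc ⊢
  refine ⟨h.eq_of_mem p q z hab hac hc, fun x hx => ?_⟩
  obtain ⟨r, rfl, hr'⟩ := hπ.convex.exists_fst_eq (T := Setoid.ker π) (p := p) (q := q) hab hx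
  rw [h.eq_of_mem p r z hr' hac hc, desc_apply]
  exact hr'.symm

end IsVerticalCoordinate

theorem exists_pos_forall_le_of_isClosed {K : Type*} [TopologicalSpace K] [CompactSpace K]
    {s : Set K} (hs : IsClosed s) {f : K → ℝ} (hf : Continuous f) (h : ∀ k ∈ s, 0 < f k) :
    ∃ z : ℝ, 0 < z ∧ ∀ k ∈ s, z ≤ f k :=
  hs.isCompact.exists_forall_le' hf.continuousOn h

/-- A curve crossing all rows of the square, such that every fiber meeting it is a horizontal
segment not reaching the left and right sides. -/
structure IsSpine {X : Type*} [TopologicalSpace X] (ρ : C(I × I, X)) (γ : C(I, I)) : Prop where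
  snd_eq : ∀ p w, ρ p = ρ (γ w, w) → p.2 = w
  fill : ∀ p w, ρ p = ρ (γ w, w) → ∀ x ∈ uIcc p.1 (γ w), ρ (x, w) = ρ p
  ne_side : ∀ p w, ρ p = ρ (γ w, w) → p.1 ≠ 0 ∧ p.1 ≠ 1

namespace IsSpine

variable {X : Type*} [MetricSpace X] {ρ : C(I × I, X)} {γ : C(I, I)}

/-- The union of the fibers meeting the spine. -/
def core (ρ : C(I × I, X)) (γ : C(I, I)) : Set (I × I) := {p | ρ p = ρ (γ p.2, p.2)}

/-- Coordinates in which the spine is a vertical segment. -/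
def straighten (γ : C(I, I)) (p : I × I) : ℝ × ℝ := ((p.1 : ℝ) - γ p.2, (p.2 : ℝ))

theorem continuous_straighten (γ : C(I, I)) : Continuous (straighten γ) := by
  unfold straighten
  fun_prop

theorem straighten_injective (γ : C(I, I)) : Function.Injective (straighten γ) := by
  intro p q h
  simp only [straighten, Prod.mk.injEq] at h
  have h2 : p.2 = q.2 := Subtype.ext h.2
  refine Prod.ext (Subtype.ext ?_) h2
  have := h.1
  rw [h2] at this
  linarith

theorem isCompact_core (ρ : C(I × I, X)) (γ : C(I, I)) : IsCompact (core ρ γ) :=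
  (isClosed_eq (by fun_prop) (by fun_prop)).isCompact

theorem core_nonempty : (core ρ γ).Nonempty := ⟨(γ 0, 0), rfl⟩

/-- The distance from the core, in straightened coordinates. -/
noncomputable def gauge (ρ : C(I × I, X)) (γ : C(I, I)) (p : I × I) : ℝ :=
  Metric.infDist (straighten γ p) (straighten γ '' core ρ γ)

theorem continuous_gauge : Continuous (gauge ρ γ) :=
  (Metric.continuous_infDist_pt _).comp (continuous_straighten γ)

theorem gauge_nonneg (p : I × I) : 0 ≤ gauge ρ γ p := Metric.infDist_nonneg

theorem gauge_eq_zero_iff {p : I × I} : gauge ρ γ p = 0 ↔ p ∈ core ρ γ := by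
  have hc := (isCompact_core ρ γ).image (continuous_straighten γ)
  rw [gauge, ← hc.isClosed.mem_iff_infDist_zero (core_nonempty.image _),
    (straighten_injective γ).mem_set_image]

theorem gauge_pos_iff {p : I × I} : 0 < gauge ρ γ p ↔ p ∉ core ρ γ := by
  rw [← gauge_eq_zero_iff, (gauge_nonneg p).lt_iff_ne']

theorem mem_core_of_eq (h : IsSpine ρ γ) {p q : I × I} (hpq : ρ p = ρ q) (hp : p ∈ core ρ γ) :
    q ∈ core ρ γ ∧ q.2 = p.2 := by
  have hq : ρ q = ρ (γ p.2, p.2) := hpq.symm.trans hp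
  have h2 := h.snd_eq q p.2 hq
  refine ⟨?_, h2⟩
  change ρ q = ρ (γ q.2, q.2)
  rw [h2]
  exact hq

theorem gauge_le_of_mem_uIcc (h : IsSpine ρ γ) {p : I × I} {x : I} (hx : x ∈ uIcc p.1 (γ p.2)) :
    gauge ρ γ (x, p.2) ≤ gauge ρ γ p := by
  refine (Metric.le_infDist (core_nonempty.image _)).2 ?_
  rintro _ ⟨q, hq, rfl⟩
  have key : ∃ y ∈ uIcc q.1 (γ q.2), |((x : ℝ) - γ p.2) - (y - γ q.2)| ≤
      |((p.1 : ℝ) - γ p.2) - (q.1 - γ q.2)| := by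
    have hx' : ((p.1 : ℝ) ≤ x ∧ (x : ℝ) ≤ γ p.2) ∨ ((γ p.2 : ℝ) ≤ x ∧ (x : ℝ) ≤ p.1) :=
      mem_uIcc.1 hx
    rcases le_total (q.1 : ℝ) (γ q.2) with hq' | hq'
    · by_cases h1 : (x : ℝ) - γ p.2 ≤ q.1 - γ q.2
      · refine ⟨q.1, left_mem_uIcc, ?_⟩
        rw [abs_le]
        rcases hx' with hx' | hx' <;>
        cases abs_cases ((p.1 : ℝ) - γ p.2 - (q.1 - γ q.2)) <;> constructor <;> linarith
      · by_cases h2 : (x : ℝ) - γ p.2 ≤ 0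
        · refine ⟨⟨x - γ p.2 + γ q.2, ?_, ?_⟩, ?_, ?_⟩
          · linarith [q.1.2.1]
          · linarith [(γ q.2).2.2]
          · refine mem_uIcc.2 (Or.inl ⟨?_, ?_⟩)
            · change (q.1 : ℝ) ≤ x - γ p.2 + γ q.2
              linarith
            · change (x - γ p.2 + γ q.2 : ℝ) ≤ γ q.2
              linarith
          · simp
        · refine ⟨γ q.2, right_mem_uIcc, ?_⟩
          rw [abs_le]
          rcases hx' with hx' | hx' <;>
          cases abs_cases ((p.1 : ℝ) - γ p.2 - (q.1 - γ q.2)) <;> constructor <;> linarith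
    · by_cases h1 : (q.1 : ℝ) - γ q.2 ≤ (x : ℝ) - γ p.2
      · refine ⟨q.1, left_mem_uIcc, ?_⟩
        rw [abs_le]
        rcases hx' with hx' | hx' <;>
        cases abs_cases ((p.1 : ℝ) - γ p.2 - (q.1 - γ q.2)) <;> constructor <;> linarith
      · by_cases h2 : 0 ≤ (x : ℝ) - γ p.2
        · refine ⟨⟨x - γ p.2 + γ q.2, ?_, ?_⟩, ?_, ?_⟩
          · linarith [(γ q.2).2.1]
          · linarith [q.1.2.2]
          · refine mem_uIcc.2 (Or.inr ⟨?_, ?_⟩)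
            · change (γ q.2 : ℝ) ≤ x - γ p.2 + γ q.2
              linarith
            · change (x - γ p.2 + γ q.2 : ℝ) ≤ q.1
              linarith
          · simp
        · refine ⟨γ q.2, right_mem_uIcc, ?_⟩
          rw [abs_le]
          rcases hx' with hx' | hx' <;>
          cases abs_cases ((p.1 : ℝ) - γ p.2 - (q.1 - γ q.2)) <;> constructor <;> linarith
  obtain ⟨y, hy, hle⟩ := key
  have hyc : (y, q.2) ∈ core ρ γ := (h.fill q q.2 hq y hy).trans hq
  refine (Metric.infDist_le_dist_of_mem (mem_image_of_mem _ hyc)).trans ?_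
  simp only [straighten, Prod.dist_eq, Real.dist_eq]
  exact max_le_max hle le_rfl

theorem exists_nested (h : IsSpine ρ γ) {ζ : ℝ} (hζ : 0 < ζ) :
    ∃ ζ' : ℝ, 0 < ζ' ∧ ζ' < ζ ∧ ∀ p q, ρ p = ρ q → gauge ρ γ p ≤ ζ' → gauge ρ γ q < ζ := by
  have hg := continuous_gauge (ρ := ρ) (γ := γ)
  obtain ⟨b, hb, hbs⟩ := exists_pos_forall_le_of_isClosed
    (s := {k : (I × I) × (I × I) | ρ k.1 = ρ k.2} ∩ {k | ζ ≤ gauge ρ γ k.2})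
    ((isClosed_eq (by fun_prop) (by fun_prop)).inter (isClosed_le (by fun_prop) (by fun_prop)))
    (f := fun k => gauge ρ γ k.1) (by fun_prop) (by
      rintro ⟨p, q⟩ ⟨hpq, hq⟩
      refine gauge_pos_iff.2 fun hp => ?_
      have h0 := gauge_eq_zero_iff.2 (h.mem_core_of_eq hpq hp).1
      have hq' : ζ ≤ gauge ρ γ q := hq
      rw [h0] at hq'
      linarith)
  refine ⟨min b ζ / 2, by positivity, by linarith [min_le_right b ζ], fun p q hpq hp => ?_⟩
  by_contra hq
  have := hbs (p, q) ⟨hpq, not_lt.1 hq⟩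
  simp only at this
  have := lt_min hb hζ
  linarith [min_le_left b ζ]

end IsSpine

/-- The piecewise linear function equal to `1` on `(-∞, b]` and to `0` on `[a, ∞)`. -/
noncomputable def ramp (a b r : ℝ) : ℝ := max 0 (min 1 ((a - r) / (a - b)))

theorem ramp_nonneg (a b r : ℝ) : 0 ≤ ramp a b r := le_max_left _ _

theorem ramp_le_one (a b r : ℝ) : ramp a b r ≤ 1 := max_le zero_le_one (min_le_left _ _)

theorem continuous_ramp (a b : ℝ) : Continuous (ramp a b) := by
  unfold ramp
  fun_prop

theorem ramp_antitone {a b : ℝ} (h : b < a) : Antitone (ramp a b) := by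
  intro r s hrs
  unfold ramp
  have := sub_pos.2 h
  gcongr

theorem ramp_eq_zero {a b r : ℝ} (h : b < a) (hr : a ≤ r) : ramp a b r = 0 :=
  max_eq_left ((min_le_right _ _).trans
    (div_nonpos_of_nonpos_of_nonneg (sub_nonpos.2 hr) (sub_nonneg.2 h.le)))

theorem ramp_eq_one {a b r : ℝ} (h : b < a) (hr : r ≤ b) : ramp a b r = 1 := by
  unfold ramp
  rw [min_eq_left, max_eq_right zero_le_one]
  rw [one_le_div (sub_pos.2 h)]
  linarith

/-- The squeezing profile along a spine. -/
structure IsProfile {X : Type*} [MetricSpace X] (ρ : C(I × I, X)) (γ : C(I, I)) (δ : ℝ)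
    (ψ : C(I × I, ℝ)) : Prop where
  nonneg : ∀ p, 0 ≤ ψ p
  lt_one : ∀ p, ψ p < 1
  side : ∀ p : I × I, p.1 = 0 ∨ p.1 = 1 → ψ p = 0
  mono : ∀ p : I × I, ∀ x ∈ uIcc p.1 (γ p.2), ψ p ≤ ψ (x, p.2)
  fiber : ∀ p q, ρ p = ρ q → ψ p ≤ ψ q + δ
  core : ∀ p, ρ p = ρ (γ p.2, p.2) → 1 - ψ p ≤ δ
  spine : ∀ p q, ρ p = ρ q → ψ p ≠ 0 → |(γ p.2 : ℝ) - γ q.2| ≤ δ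
  close : ∀ p : I × I, ∀ x ∈ uIcc p.1 (γ p.2), ψ p ≠ 0 → dist (ρ (x, p.2)) (ρ p) ≤ δ

theorem IsSpine.exists_isProfile {X : Type*} [MetricSpace X] {ρ : C(I × I, X)} {γ : C(I, I)}
    (h : IsSpine ρ γ) {δ : ℝ} (hδ : 0 < δ) (hδ1 : δ ≤ 1) : ∃ ψ, IsProfile ρ γ δ ψ := by
  have hg := continuous_gauge (ρ := ρ) (γ := γ)
  set r := gauge ρ γ with hr
  obtain ⟨za, hza, hza'⟩ := exists_pos_forall_le_of_isClosed
    (s := {k : I × I | k.1 = 0 ∨ k.1 = 1})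
    ((isClosed_eq (by fun_prop) (by fun_prop)).union (isClosed_eq (by fun_prop) (by fun_prop))) hg
    (fun p hp => gauge_pos_iff.2 fun hc => by
      have := h.ne_side p p.2 hc
      simp only [mem_ofPred_eq] at hp
      tauto)
  obtain ⟨zb, hzb, hzb'⟩ := exists_pos_forall_le_of_isClosed
    (s := {k : (I × I) × (I × I) | ρ k.1 = ρ k.2} ∩ {k | δ ≤ |(γ k.1.2 : ℝ) - γ k.2.2|})
    ((isClosed_eq (by fun_prop) (by fun_prop)).inter (isClosed_le (by fun_prop) (by fun_prop)))
    (f := fun k => r k.1) (by fun_prop) (by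
      rintro ⟨p, q⟩ ⟨hpq, hq⟩
      refine gauge_pos_iff.2 fun hc => ?_
      have h2 : q.2 = p.2 := (h.mem_core_of_eq hpq hc).2
      have hq' : δ ≤ |(γ p.2 : ℝ) - γ q.2| := hq
      rw [h2, sub_self, abs_zero] at hq'
      linarith)
  obtain ⟨zc, hzc, hzc'⟩ := exists_pos_forall_le_of_isClosed
    (s := {k : (I × I) × I | ((k.1.1 ≤ k.2 ∧ k.2 ≤ γ k.1.2) ∨ (γ k.1.2 ≤ k.2 ∧ k.2 ≤ k.1.1))} ∩
      {k | δ ≤ dist (ρ (k.2, k.1.2)) (ρ k.1)})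
    ((((isClosed_le (by fun_prop) (by fun_prop)).inter
      (isClosed_le (by fun_prop) (by fun_prop))).union
      ((isClosed_le (by fun_prop) (by fun_prop)).inter
      (isClosed_le (by fun_prop) (by fun_prop)))).inter (isClosed_le (by fun_prop) (by fun_prop)))
    (f := fun k => r k.1) (by fun_prop) (by
      rintro ⟨p, x⟩ ⟨hx, hd⟩
      refine gauge_pos_iff.2 fun hc => ?_
      have := h.fill p p.2 hc x (mem_uIcc.2 hx)
      have hd' : δ ≤ dist (ρ (x, p.2)) (ρ p) := hd
      rw [this, dist_self] at hd'
      linarith)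
  choose N hN0 hNlt hN using fun ζ : {ζ : ℝ // 0 < ζ} => h.exists_nested ζ.2
  let Z : ℕ → {ζ : ℝ // 0 < ζ} := fun n =>
    Nat.rec ⟨min za (min zb zc), lt_min hza (lt_min hzb hzc)⟩ (fun _ ζ => ⟨N ζ, hN0 ζ⟩) n
  set z : ℕ → ℝ := fun n => (Z n).1 with hz
  have hz0 : z 0 = min za (min zb zc) := rfl
  have hzpos : ∀ n, 0 < z n := fun n => (Z n).2
  have hzlt : ∀ n, z (n + 1) < z n := fun n => hNlt (Z n)
  have hznest : ∀ n p q, ρ p = ρ q → r p ≤ z (n + 1) → r q < z n := fun n => hN (Z n)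
  have hzanti : Antitone z := antitone_nat_of_succ_le fun n => (hzlt n).le
  obtain ⟨m, hm⟩ := exists_nat_gt (2 / δ)
  have hm' : 2 / ((m : ℝ) + 2) ≤ δ := by
    rw [div_le_iff₀ (by positivity)]
    rw [div_lt_iff₀ hδ] at hm
    nlinarith
  let s : ℝ → ℝ := fun t => ∑ l ∈ Finset.range (m + 2), ramp (z l) (z (l + 1)) t
  have hs_cont : Continuous s := by
    refine continuous_finsetSum _ fun l _ => continuous_ramp _ _
  have hs_nonneg : ∀ t, 0 ≤ s t := fun t => Finset.sum_nonneg fun l _ => ramp_nonneg _ _ _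
  have hs_le : ∀ t, s t ≤ m + 2 := by
    intro t
    refine (Finset.sum_le_card_nsmul _ _ 1 fun l _ => ramp_le_one _ _ _).trans ?_
    simp
  have hs_anti : Antitone s := fun a b hab =>
    Finset.sum_le_sum fun l _ => ramp_antitone (hzlt l) hab
  have hs_zero : ∀ t, z 0 ≤ t → s t = 0 := fun t ht =>
    Finset.sum_eq_zero fun l _ => ramp_eq_zero (hzlt l) ((hzanti l.zero_le).trans ht)
  have hs_zero' : s 0 = m + 2 := by
    simp only [s]
    rw [Finset.sum_congr rfl fun l _ => ramp_eq_one (hzlt l) (hzpos (l + 1)).le]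
    simp
  have hs_fiber : ∀ p q, ρ p = ρ q → s (r p) ≤ s (r q) + 2 := by
    intro p q hpq
    have h1 : s (r p) ≤ ∑ l ∈ Finset.range m, ramp (z (l + 2)) (z (l + 3)) (r p) + 2 := by
      simp only [s]
      rw [Finset.sum_range_succ', Finset.sum_range_succ']
      have := ramp_le_one (z 0) (z (0 + 1)) (r p)
      have := ramp_le_one (z (0 + 1)) (z (0 + 1 + 1)) (r p)
      linarith
    have h2 : ∑ l ∈ Finset.range m, ramp (z (l + 2)) (z (l + 3)) (r p) ≤
        ∑ l ∈ Finset.range m, ramp (z l) (z (l + 1)) (r q) := by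
      refine Finset.sum_le_sum fun l _ => ?_
      rcases le_or_gt (z (l + 2)) (r p) with hl | hl
      · rw [ramp_eq_zero (hzlt (l + 2)) hl]
        exact ramp_nonneg _ _ _
      · rw [ramp_eq_one (hzlt l) (hznest (l + 1) p q hpq hl.le).le]
        exact ramp_le_one _ _ _
    have h3 : ∑ l ∈ Finset.range m, ramp (z l) (z (l + 1)) (r q) ≤ s (r q) :=
      Finset.sum_le_sum_of_subset_of_nonneg (Finset.range_mono (by omega))
        fun l _ _ => ramp_nonneg _ _ _
    linarith
  have hm0 : (0 : ℝ) < m + 2 := by positivity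
  have hψ : ∀ p, (1 - δ) * (s (r p) / (m + 2)) ≠ 0 → r p < z 0 := by
    intro p hp
    by_contra hn
    exact hp (by rw [hs_zero _ (not_lt.1 hn)]; simp)
  refine ⟨⟨fun p => (1 - δ) * (s (r p) / (m + 2)), by fun_prop⟩, ?_, ?_, ?_, ?_, ?_, ?_, ?_, ?_⟩
  · intro p
    exact mul_nonneg (sub_nonneg.2 hδ1) (div_nonneg (hs_nonneg _) hm0.le)
  · intro p
    have : s (r p) / (m + 2) ≤ 1 := (div_le_one hm0).2 (hs_le _)
    exact (mul_le_of_le_one_right (sub_nonneg.2 hδ1) this).trans_lt (by linarith)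
  · intro p hp
    by_contra hn
    exact absurd (hza' p hp) (not_le.2 ((hψ p hn).trans_le (min_le_left _ _)))
  · intro p x hx
    refine mul_le_mul_of_nonneg_left ?_ (sub_nonneg.2 hδ1)
    exact div_le_div_of_nonneg_right (hs_anti (h.gauge_le_of_mem_uIcc hx)) hm0.le
  · intro p q hpq
    have h1 : s (r p) / (m + 2) ≤ s (r q) / (m + 2) + δ := by
      refine (div_le_div_of_nonneg_right (hs_fiber p q hpq) hm0.le).trans ?_
      rw [add_div]
      linarith
    have h2 := mul_le_mul_of_nonneg_left h1 (sub_nonneg.2 hδ1)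
    simp only [ContinuousMap.coe_mk]
    nlinarith
  · intro p hp
    have : r p = 0 := gauge_eq_zero_iff.2 hp
    simp [this, hs_zero', hm0.ne']
  · intro p q hpq hp
    by_contra hn
    exact absurd (hzb' (p, q) ⟨hpq, (not_le.1 hn).le⟩)
      (not_le.2 ((hψ p hp).trans_le ((min_le_right _ _).trans (min_le_left _ _))))
  · intro p x hx hp
    by_contra hn
    exact absurd (hzc' (p, x) ⟨mem_uIcc.1 hx, (not_le.1 hn).le⟩)
      (not_le.2 ((hψ p hp).trans_le ((min_le_right _ _).trans (min_le_right _ _))))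

/-- Squeezing the square along its rows towards a spine. -/
theorem IsSpine.exists_squeeze {X : Type*} [MetricSpace X] {ρ : C(I × I, X)} {γ : C(I, I)}
    (h : IsSpine ρ γ) {δ : ℝ} (hδ : 0 < δ) : ∃ H : (I × I) ≃ₜ (I × I),
      (∀ p, (H p).2 = p.2) ∧ (∀ w, StrictMono fun x => (H (x, w)).1) ∧
      (∀ p : I × I, p.1 = 0 ∨ p.1 = 1 → H p = p) ∧
      (∀ p q, ρ p = ρ q → |((H p).1 : ℝ) - (H q).1| ≤ |(p.1 : ℝ) - q.1| + δ) ∧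
      (∀ p q, ρ p = ρ q → ρ p = ρ (γ p.2, p.2) → |((H p).1 : ℝ) - (H q).1| ≤ δ) ∧
      ∀ p, dist (ρ (H p)) (ρ p) ≤ δ := by
  obtain ⟨ψ, hψ⟩ := h.exists_isProfile (δ := min (δ / 2) 1) (by positivity) (min_le_right _ _)
  have hδ2 := min_le_left (δ / 2) 1
  set η := min (δ / 2) 1 with hη
  have hmem : ∀ p : I × I, (p.1 + ψ p * (γ p.2 - p.1) : ℝ) ∈ I := fun p =>
    convexComb_mem_unitInterval _ _ (hψ.nonneg p) (hψ.lt_one p).le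
  let f : I × I → I × I := fun p => (⟨_, hmem p⟩, p.2)
  have hf1 : ∀ p, ((f p).1 : ℝ) = p.1 + ψ p * (γ p.2 - p.1) := fun p => rfl
  have hf2 : ∀ p, (f p).2 = p.2 := fun p => rfl
  have hfc : Continuous f := by fun_prop
  have hbtw : ∀ p, (f p).1 ∈ uIcc p.1 (γ p.2) := by
    intro p
    have h0 := hψ.nonneg p
    have h1 := (hψ.lt_one p).le
    rw [mem_uIcc]
    rcases le_total (p.1 : ℝ) (γ p.2) with hle | hle
    · refine Or.inl ⟨?_, ?_⟩
      · change (p.1 : ℝ) ≤ p.1 + ψ p * (γ p.2 - p.1)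
        nlinarith
      · change (p.1 + ψ p * (γ p.2 - p.1) : ℝ) ≤ γ p.2
        nlinarith
    · refine Or.inr ⟨?_, ?_⟩
      · change (γ p.2 : ℝ) ≤ p.1 + ψ p * (γ p.2 - p.1)
        nlinarith
      · change (p.1 + ψ p * (γ p.2 - p.1) : ℝ) ≤ p.1
        nlinarith
  have hside : ∀ p : I × I, p.1 = 0 ∨ p.1 = 1 → f p = p := by
    intro p hp
    refine Prod.ext (Subtype.ext ?_) rfl
    rw [hf1, hψ.side p hp]
    ring
  have hstrict : ∀ (w x x' : I), x < x' → (f (x, w)).1 < (f (x', w)).1 := by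
    intro w x x' hx
    have hxr : (x : ℝ) < x' := hx
    rw [← Subtype.coe_lt_coe, hf1, hf1]
    simp only
    have h1 := hψ.lt_one (x, w)
    have h1' := hψ.lt_one (x', w)
    rcases le_total (x' : ℝ) (γ w) with hle | hle
    · have hm := hψ.mono (x, w) x' (mem_uIcc.2 (Or.inl ⟨hx.le, hle⟩))
      simp only at hm
      nlinarith
    · rcases le_total (γ w : ℝ) x with hle' | hle'
      · have hm := hψ.mono (x', w) x (mem_uIcc.2 (Or.inr ⟨hle', hx.le⟩))
        simp only at hm
        nlinarith
      · have h2 := mul_nonneg (sub_pos.2 h1).le (sub_nonneg.2 hle')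
        have h2' := mul_nonneg (sub_pos.2 h1').le (sub_nonneg.2 hle)
        rcases hle'.lt_or_eq with hlt | heq
        · have := mul_pos (sub_pos.2 h1) (sub_pos.2 hlt)
          linarith
        · have := mul_pos (sub_pos.2 h1') (sub_pos.2 (heq ▸ hxr))
          linarith
  have hinj : Function.Injective f := by
    rintro ⟨x, w⟩ ⟨x', w'⟩ hxx
    obtain rfl : w = w' := congrArg Prod.snd hxx
    rcases lt_trichotomy x x' with hlt | rfl | hlt
    · exact absurd (congrArg Prod.fst hxx) (hstrict w x x' hlt).ne
    · rfl
    · exact absurd (congrArg Prod.fst hxx) (hstrict w x' x hlt).ne'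
  have hsurj : Function.Surjective f := by
    rintro ⟨x, w⟩
    obtain ⟨y, hy⟩ := mem_range_of_exists_le_of_exists_ge (f := fun y => (f (y, w)).1) (c := x)
      (by fun_prop) ⟨0, by simp [hside (0, w)]⟩
      ⟨1, by simp [hside (1, w), unitInterval.le_one']⟩
    exact ⟨(y, w), Prod.ext hy rfl⟩
  have hid : ∀ p q, ((f p).1 : ℝ) - (f q).1 = (1 - ψ p) * (p.1 - q.1) +
      (ψ q - ψ p) * (q.1 - γ q.2) + ψ p * (γ p.2 - γ q.2) := by
    intro p q
    rw [hf1, hf1]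
    ring
  have hq1 : ∀ x y : I, |(x : ℝ) - y| ≤ 1 := by
    intro x y
    rw [abs_le]
    constructor <;> linarith [x.2.1, x.2.2, y.2.1, y.2.2]
  have hψη : ∀ p q, ρ p = ρ q → |(ψ q - ψ p) * (q.1 - γ q.2)| ≤ η := by
    intro p q hpq
    rw [abs_mul]
    have h1 : |ψ q - ψ p| ≤ η := by
      rw [abs_le]
      constructor <;> linarith [hψ.fiber p q hpq, hψ.fiber q p hpq.symm]
    exact (mul_le_of_le_one_right (abs_nonneg _) (hq1 _ _)).trans h1
  refine ⟨Continuous.homeoOfEquivCompactToT2 (f := Equiv.ofBijective f ⟨hinj, hsurj⟩) hfc,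
    hf2, hstrict, hside, ?_, ?_, ?_⟩
  · intro p q hpq
    change |((f p).1 : ℝ) - (f q).1| ≤ _
    rw [hid]
    refine (abs_add_three _ _ _).trans ?_
    have h1 : |(1 - ψ p) * ((p.1 : ℝ) - q.1)| ≤ |(p.1 : ℝ) - q.1| := by
      rw [abs_mul, abs_of_pos (by linarith [hψ.lt_one p])]
      exact mul_le_of_le_one_left (abs_nonneg _) (by linarith [hψ.nonneg p])
    have h3 : |ψ p * ((γ p.2 : ℝ) - γ q.2)| ≤ η := by
      by_cases h0 : ψ p = 0
      · rw [h0, zero_mul, abs_zero]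
        positivity
      · rw [abs_mul, abs_of_nonneg (hψ.nonneg p)]
        exact (mul_le_of_le_one_left (abs_nonneg _) (hψ.lt_one p).le).trans (hψ.spine p q hpq h0)
    linarith [hψη p q hpq]
  · intro p q hpq hp
    change |((f p).1 : ℝ) - (f q).1| ≤ _
    rw [hid, (h.mem_core_of_eq hpq hp).2, sub_self, mul_zero, add_zero]
    refine (abs_add_le _ _).trans ?_
    have h1 : |(1 - ψ p) * ((p.1 : ℝ) - q.1)| ≤ η := by
      rw [abs_mul, abs_of_pos (by linarith [hψ.lt_one p])]
      exact (mul_le_of_le_one_right (by linarith [hψ.lt_one p]) (hq1 _ _)).trans (hψ.core p hp)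
    have h2 := hψη p q hpq
    rw [(h.mem_core_of_eq hpq hp).2] at h2
    linarith
  · intro p
    change dist (ρ (f p)) (ρ p) ≤ δ
    by_cases h0 : ψ p = 0
    · have : f p = p := by
        refine Prod.ext (Subtype.ext ?_) rfl
        rw [hf1, h0]
        ring
      rw [this, dist_self]
      exact hδ.le
    · have : dist (ρ (f p)) (ρ p) ≤ η := hψ.close p (f p).1 (hbtw p) h0
      linarith

/-- A map of the square for which the fibers meeting the vertical lines over `F` are horizontal
segments, and for which the points of the left and right sides are alone in their fiber. -/
structure HorizontalOver {X : Type*} [TopologicalSpace X] (ρ : C(I × I, X)) (F : Finset I) :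
    Prop where
  ne_side : ∀ c ∈ F, c ≠ 0 ∧ c ≠ 1
  eq_of_side : ∀ a b, ρ a = ρ b → a.1 = 0 ∨ a.1 = 1 → a = b
  horizontal : ∀ a b c, ρ a = ρ b → ρ a = ρ c → c.1 ∈ F →
    a.2 = b.2 ∧ ∀ x ∈ uIcc a.1 b.1, ρ (x, a.2) = ρ a

theorem HorizontalOver.exists_squeeze {X : Type*} [MetricSpace X] {ρ : C(I × I, X)} {F : Finset I}
    (h : HorizontalOver ρ F) {δ : ℝ} (hδ : 0 < δ) : ∃ H : (I × I) ≃ₜ (I × I),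
      (∀ p, (H p).2 = p.2) ∧ (∀ w, StrictMono fun x => (H (x, w)).1) ∧
      (∀ p : I × I, p.1 = 0 ∨ p.1 = 1 → H p = p) ∧
      (∀ p q, ρ p = ρ q → |((H p).1 : ℝ) - (H q).1| ≤ |(p.1 : ℝ) - q.1| + F.card * δ) ∧
      (∀ p q z, ρ p = ρ q → ρ p = ρ z → z.1 ∈ F → |((H p).1 : ℝ) - (H q).1| ≤ F.card * δ) ∧
      ∀ p, dist (ρ (H p)) (ρ p) ≤ F.card * δ := by
  classical
  induction F using Finset.induction_on with
  | empty =>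
    refine ⟨Homeomorph.refl _, fun _ => rfl, fun _ _ _ h => h, fun _ _ => rfl, ?_, ?_, ?_⟩ <;> simp
  | insert c G hc ih =>
    obtain ⟨H, hrow, hmono, hside, hw1, hw2, hdist⟩ := ih
      ⟨fun d hd => h.ne_side d (Finset.mem_insert_of_mem hd), h.eq_of_side,
        fun a b d hab had hd => h.horizontal a b d hab had (Finset.mem_insert_of_mem hd)⟩
    have hrow' : ∀ p, (H.symm p).2 = p.2 := fun p => by rw [← hrow, H.apply_symm_apply]
    have hcF := Finset.mem_insert_self c G
    let ρ' : C(I × I, X) := ρ.comp H.symm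
    let γ : C(I, I) := ⟨fun w => (H (c, w)).1, by fun_prop⟩
    have hγ : ∀ w, (γ w, w) = H (c, w) := fun w => Prod.ext rfl (hrow (c, w)).symm
    have hργ : ∀ w, ρ' (γ w, w) = ρ (c, w) := by
      intro w
      change ρ (H.symm (γ w, w)) = _
      rw [hγ, H.symm_apply_apply]
    have hsp : IsSpine ρ' γ := by
      constructor
      · intro p w hp
        rw [hργ] at hp
        rw [← hrow' p]
        exact (h.horizontal (H.symm p) (c, w) (c, w) hp hp hcF).1
      · intro p w hp x hx
        rw [hργ] at hp
        obtain ⟨h2, hfill⟩ := h.horizontal (H.symm p) (c, w) (c, w) hp hp hcF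
        have hx' : (H.symm (x, w)).1 ∈ uIcc (H.symm p).1 c := by
          have e1 : (x, w) = H ((H.symm (x, w)).1, w) := by
            conv_lhs => rw [← H.apply_symm_apply (x, w)]
            exact congrArg H (Prod.ext rfl (hrow' _))
          have e2 : p = H ((H.symm p).1, w) := by
            conv_lhs => rw [← H.apply_symm_apply p]
            exact congrArg H (Prod.ext rfl h2)
          have e1' : x = (H ((H.symm (x, w)).1, w)).1 := congrArg Prod.fst e1
          have e2' : p.1 = (H ((H.symm p).1, w)).1 := congrArg Prod.fst e2
          have := mem_uIcc.1 hx
          rw [e2', e1'] at this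
          change ((H ((H.symm p).1, w)).1 ≤ _ ∧ _ ≤ (H (c, w)).1) ∨
            ((H (c, w)).1 ≤ _ ∧ _ ≤ (H ((H.symm p).1, w)).1) at this
          rw [(hmono w).le_iff_le, (hmono w).le_iff_le, (hmono w).le_iff_le,
            (hmono w).le_iff_le] at this
          exact mem_uIcc.2 this
        have := hfill _ hx'
        rw [h2] at this
        change ρ (H.symm (x, w)) = ρ (H.symm p)
        rw [← this]
        exact congrArg ρ (Prod.ext rfl (hrow' _))
      · intro p w hp
        rw [hργ] at hp
        by_contra hn
        have hp' : p.1 = 0 ∨ p.1 = 1 := by tauto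
        have hHp : H.symm p = p := by
          rw [H.symm_apply_eq, hside p hp']
        change ρ (H.symm p) = _ at hp
        rw [hHp] at hp
        have := h.eq_of_side p (c, w) hp hp'
        rw [this] at hp'
        have := h.ne_side c hcF
        tauto
    obtain ⟨K, krow, kmono, kside, kw1, kw2, kdist⟩ := hsp.exists_squeeze hδ
    have hρ'H : ∀ p, ρ' (H p) = ρ p := fun p => congrArg ρ (H.symm_apply_apply p)
    have hcard : ((insert c G).card : ℝ) * δ = G.card * δ + δ := by
      rw [Finset.card_insert_of_notMem hc]
      push_cast
      ring
    have hGδ : 0 ≤ (G.card : ℝ) * δ := by positivity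
    rw [hcard]
    refine ⟨H.trans K, fun p => (krow _).trans (hrow p), ?_, ?_, ?_, ?_, ?_⟩
    · intro w x y hxy
      have e : ∀ x, H (x, w) = ((H (x, w)).1, w) := fun x => Prod.ext rfl (hrow _)
      change (K (H (x, w))).1 < (K (H (y, w))).1
      rw [e x, e y]
      exact kmono w (hmono w hxy)
    · intro p hp
      change K (H p) = p
      rw [hside p hp, kside p hp]
    · intro p q hpq
      have h1 := kw1 (H p) (H q) (by rw [hρ'H, hρ'H, hpq])
      have h2 := hw1 p q hpq
      change |((K (H p)).1 : ℝ) - (K (H q)).1| ≤ _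
      linarith
    · intro p q z hpq hpz hz
      change |((K (H p)).1 : ℝ) - (K (H q)).1| ≤ _
      rcases Finset.mem_insert.1 hz with hz' | hz'
      · have h2 := (h.horizontal p z z hpz hpz hz).1
        have := kw2 (H p) (H q) (by rw [hρ'H, hρ'H, hpq]) (by
          rw [hργ, hρ'H, hpz, hrow, h2, ← hz'])
        linarith
      · have h1 := kw1 (H p) (H q) (by rw [hρ'H, hρ'H, hpq])
        have h2 := hw2 p q z hpq hpz hz'
        linarith
    · intro p
      change dist (ρ (K (H p))) (ρ p) ≤ _
      have h1 := hdist (H.symm (K (H p)))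
      have h2 := kdist (H p)
      rw [H.apply_symm_apply] at h1
      rw [hρ'H] at h2
      have := dist_triangle (ρ (K (H p))) (ρ' (K (H p))) (ρ p)
      have h1' : dist (ρ (K (H p))) (ρ' (K (H p))) ≤ G.card * δ := h1
      linarith

theorem exists_grid (N : ℕ) : ∃ F : Finset I, (∀ c ∈ F, c ≠ 0 ∧ c ≠ 1) ∧
    F.card ≤ N + 1 ∧ ∀ a b : I, (a : ℝ) + 1 / (N + 1) < b → ∃ c ∈ F, a ≤ c ∧ c ≤ b := by
  classical
  have hN : (0 : ℝ) < N + 1 := by positivity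
  let g : ℕ → I := fun i => projIcc 0 1 zero_le_one ((i : ℝ) / (N + 1))
  refine ⟨((Finset.range (N + 1)).image g).filter fun c => c ≠ 0 ∧ c ≠ 1, ?_, ?_, ?_⟩
  · intro c hc
    exact (Finset.mem_filter.1 hc).2
  · exact (Finset.card_filter_le _ _).trans (Finset.card_image_le.trans (by simp))
  · intro a b hab
    have ha := a.2.1
    have hb := b.2.2
    let i := ⌊(a : ℝ) * (N + 1)⌋₊ + 1
    have h1 : (a : ℝ) * (N + 1) < i := by
      simpa [i] using Nat.lt_floor_add_one ((a : ℝ) * (N + 1))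
    have h2 : (i : ℝ) ≤ a * (N + 1) + 1 := by
      have := Nat.floor_le (a := (a : ℝ) * (N + 1)) (by positivity)
      simp only [i]
      push_cast
      linarith
    have h3 : (a : ℝ) < i / (N + 1) := by rwa [lt_div_iff₀ hN]
    have h4 : (i : ℝ) / (N + 1) < b := by
      refine lt_of_le_of_lt ?_ hab
      rw [div_le_iff₀ hN, add_mul, one_div, inv_mul_cancel₀ hN.ne']
      exact h2
    have hmem : (i : ℝ) / (N + 1) ∈ I := ⟨by linarith, by linarith⟩
    have hg : g i = ⟨_, hmem⟩ := projIcc_of_mem _ hmem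
    refine ⟨g i, Finset.mem_filter.2 ⟨Finset.mem_image_of_mem _ (Finset.mem_range.2 ?_), ?_, ?_⟩,
      ?_, ?_⟩
    · have : (i : ℝ) < N + 1 := by
        have := h4.trans_le hb
        rwa [div_lt_one hN] at this
      exact_mod_cast this
    · rw [hg]
      intro h0
      have := congrArg Subtype.val h0
      simp only [Icc.coe_zero] at this
      linarith
    · rw [hg]
      intro h0
      have := congrArg Subtype.val h0
      simp only [Icc.coe_one] at this
      linarith
    · rw [hg]
      exact h3.le
    · rw [hg]
      exact h4.le

theorem exists_modulus {Z X : Type*} [MetricSpace Z] [CompactSpace Z] [MetricSpace X]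
    {f : Z → X} (hf : Continuous f) {x : Z → ℝ} (hx : Continuous x)
    (h : ∀ a b, f a = f b → x a = x b → a = b) {ε : ℝ} (hε : 0 < ε) :
    ∃ η > 0, ∀ a b, dist (f a) (f b) + |x a - x b| < η → dist a b < ε := by
  obtain ⟨η, hη, hle⟩ := exists_pos_forall_le_of_isClosed
    (s := {k : Z × Z | ε ≤ dist k.1 k.2}) (isClosed_le (by fun_prop) (by fun_prop))
    (f := fun k => dist (f k.1) (f k.2) + |x k.1 - x k.2|) (by fun_prop) (by
      rintro ⟨a, b⟩ hab
      refine lt_of_le_of_ne (by positivity) fun h0 => ?_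
      have h1 : dist (f a) (f b) = 0 := by
        have h2 := abs_nonneg (x a - x b)
        have h3 := dist_nonneg (x := f a) (y := f b)
        simp only at h0
        linarith
      have h2 : |x a - x b| = 0 := by
        simp only [h1] at h0
        linarith
      have hab' : ε ≤ dist a b := hab
      rw [h a b (dist_eq_zero.1 h1) (sub_eq_zero.1 (abs_eq_zero.1 h2)), dist_self] at hab'
      linarith)
  refine ⟨η, hη, fun a b hab => ?_⟩
  by_contra hn
  exact absurd (hle (a, b) (not_lt.1 hn)) (not_le.2 hab)

/-- **Bing's shrinkability condition** holds for a suitable modification of a map with convex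
fibers. -/
theorem ConvexFibers.exists_shrinkable {X : Type*} [MetricSpace X] {π : C(I × I, X)}
    (hπ : ConvexFibers π) : ∃ ρ : C(I × I, X), range ρ = range π ∧ ∀ ε > 0,
      ∃ h : (I × I) ≃ₜ (I × I), (∀ p, dist (ρ (h p)) (ρ p) < ε) ∧
        ∀ p q, ρ p = ρ q → dist (h p) (h q) < ε := by
  obtain ⟨w₀, hw₀⟩ := exists_isVerticalCoordinate hπ ∅
  refine ⟨hw₀.desc, hw₀.range_desc, fun ε hε => ?_⟩
  obtain ⟨η₀, hη₀, hmod⟩ := exists_modulus (f := hw₀.desc) (x := fun p => (p.1 : ℝ))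
    hw₀.desc.continuous (by fun_prop)
    (fun a b hab h1 => hw₀.desc_eq_of_fst hab (Subtype.ext h1)) hε
  obtain ⟨η, hη, hηε, hηη⟩ : ∃ η > 0, η < ε ∧ 4 * η < η₀ :=
    ⟨min ε (η₀ / 4) / 2, by positivity, by
      linarith [min_le_left ε (η₀ / 4), lt_min hε (by positivity : 0 < η₀ / 4)],
      by linarith [min_le_right ε (η₀ / 4), lt_min hε (by positivity : 0 < η₀ / 4)]⟩
  obtain ⟨N, hN⟩ := exists_nat_one_div_lt hη
  obtain ⟨F, hFside, hFcard, hF⟩ := exists_grid N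
  obtain ⟨w, hw⟩ := exists_isVerticalCoordinate hπ F
  have hhor : HorizontalOver hw.desc F :=
    ⟨hFside, fun a b => hw.desc_eq_of_side hπ, fun a b c hab hac hc =>
      ⟨(hw.desc_horizontal hπ hab hac hc).1, fun x hx =>
        (hw.desc_horizontal hπ hab hac hc).2 x (mem_uIcc.1 hx)⟩⟩
  have hδ : 0 < η / (N + 1) := by positivity
  obtain ⟨H, -, -, -, hw1, hw2, hdist⟩ := hhor.exists_squeeze hδ
  have hcard : (F.card : ℝ) * (η / (N + 1)) ≤ η := by
    rw [mul_div_assoc', div_le_iff₀ (by positivity), mul_comm]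
    refine mul_le_mul_of_nonneg_left ?_ hη.le
    exact_mod_cast hFcard
  have hwidth : ∀ p q, hw.desc p = hw.desc q → |((H p).1 : ℝ) - (H q).1| ≤ 2 * η := by
    intro p q hpq
    by_cases hlarge : |(p.1 : ℝ) - q.1| ≤ 1 / (N + 1)
    · linarith [hw1 p q hpq]
    · have : ∃ c ∈ F, (p.1 ≤ c ∧ c ≤ q.1) ∨ (q.1 ≤ c ∧ c ≤ p.1) := by
        rcases lt_abs.1 (not_le.1 hlarge) with h | h
        · obtain ⟨c, hc, hc'⟩ := hF q.1 p.1 (by linarith)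
          exact ⟨c, hc, Or.inr hc'⟩
        · obtain ⟨c, hc, hc'⟩ := hF p.1 q.1 (by linarith)
          exact ⟨c, hc, Or.inl hc'⟩
      obtain ⟨c, hc, hcb⟩ := this
      obtain ⟨y, hy⟩ := hw.exists_desc_eq hπ hpq hcb
      linarith [hw2 p q (c, y) hpq hy hc]
  obtain ⟨θ, hθ1, hθ⟩ := hw₀.exists_homeomorph hw
  have hclose : ∀ p, dist (hw₀.desc ((θ.trans (H.trans θ.symm)) p)) (hw₀.desc p) ≤ η := by
    intro p
    rw [← hθ, ← hθ]
    change dist (hw.desc (θ (θ.symm (H (θ p))))) _ ≤ _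
    rw [θ.apply_symm_apply]
    exact (hdist _).trans hcard
  have hfst : ∀ p, ((θ.trans (H.trans θ.symm)) p).1 = (H (θ p)).1 := by
    intro p
    rw [← hθ1]
    change (θ (θ.symm (H (θ p)))).1 = _
    rw [θ.apply_symm_apply]
  refine ⟨θ.trans (H.trans θ.symm), fun p => (hclose p).trans_lt hηε, fun p q hpq => hmod _ _ ?_⟩
  have h1 := hwidth (θ p) (θ q) (by rw [hθ, hθ, hpq])
  have h2 := hclose p
  have h3 := hclose q
  rw [hpq] at h2
  have h4 := dist_triangle_right (hw₀.desc ((θ.trans (H.trans θ.symm)) p))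
    (hw₀.desc ((θ.trans (H.trans θ.symm)) q)) (hw₀.desc q)
  rw [hfst, hfst]
  linarith

/-- **Bing's shrinking criterion** for surjections of compact metric spaces. -/
theorem exists_homeomorph_of_shrinkable {Z X : Type*} [MetricSpace Z] [CompactSpace Z]
    [MetricSpace X] [CompleteSpace X] {ρ : C(Z, X)} (hsurj : Function.Surjective ρ)
    (hshrink : ∀ ε > 0, ∃ h : Z ≃ₜ Z, (∀ p, dist (ρ (h p)) (ρ p) < ε) ∧
      ∀ p q, ρ p = ρ q → dist (h p) (h q) < ε) : Nonempty (Z ≃ₜ X) := by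
  let E : Set C(Z, X) := closure (range fun h : Z ≃ₜ Z => ρ.comp (h : C(Z, Z)))
  have : CompleteSpace E := isClosed_closure.completeSpace_coe
  let O : ℕ → Set E := fun n => {q | ∀ z z', q.1 z = q.1 z' → dist z z' < 1 / ((n : ℝ) + 1)}
  have hopen : ∀ n, IsOpen (O n) := by
    intro n
    have hcl : IsClosed ({k : (Z × Z) × E | k.2.1 k.1.1 = k.2.1 k.1.2} ∩
        {k : (Z × Z) × E | 1 / ((n : ℝ) + 1) ≤ dist k.1.1 k.1.2}) :=
      (isClosed_eq (by fun_prop) (by fun_prop)).inter (isClosed_le (by fun_prop) (by fun_prop))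
    have := (isClosedMap_snd_of_compactSpace _ hcl).isOpen_compl
    convert this using 1
    ext q
    simp [O]
  have hdense : ∀ n, Dense (O n) := by
    intro n
    rw [Metric.dense_iff]
    intro q ε hε
    obtain ⟨_, ⟨h₀, rfl⟩, hq⟩ := Metric.mem_closure_iff.1 q.2 (ε / 2) (half_pos hε)
    obtain ⟨η, hη, huc⟩ := Metric.uniformContinuous_iff.1
      (CompactSpace.uniformContinuous_of_continuous h₀.symm.continuous) (1 / ((n : ℝ) + 1))
      (by positivity)
    obtain ⟨h, hclose, hsmall⟩ := hshrink (min η (ε / 2)) (by positivity)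
    let g : Z ≃ₜ Z := h₀.trans h.symm
    have hg : ∀ z, h (g z) = h₀ z := fun z => h.apply_symm_apply _
    refine ⟨⟨ρ.comp (g : C(Z, Z)), subset_closure ⟨g, rfl⟩⟩, ?_, ?_⟩
    · rw [Metric.mem_ball, Subtype.dist_eq]
      have h1 : dist (ρ.comp (g : C(Z, Z))) (ρ.comp (h₀ : C(Z, Z))) ≤ ε / 2 := by
        rw [ContinuousMap.dist_le (by positivity)]
        intro z
        have := hclose (g z)
        rw [hg, dist_comm] at this
        exact (this.trans_le (min_le_right _ _)).le
      have h2 := dist_triangle_right (ρ.comp (g : C(Z, Z))) q.1 (ρ.comp (h₀ : C(Z, Z)))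
      have h3 : dist q.1 (ρ.comp (h₀ : C(Z, Z))) < ε / 2 := hq
      linarith
    · intro z z' hz
      have h1 := hsmall (g z) (g z') hz
      rw [hg, hg] at h1
      have h2 := huc (h1.trans_le (min_le_left _ _))
      rwa [h₀.symm_apply_apply, h₀.symm_apply_apply] at h2
  have : Nonempty E := ⟨⟨ρ.comp (Homeomorph.refl Z : C(Z, Z)), subset_closure ⟨_, rfl⟩⟩⟩
  obtain ⟨q, hq⟩ := (dense_iInter_of_isOpen_nat hopen hdense).nonempty
  have hinj : Function.Injective q.1 := by
    intro z z' hz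
    by_contra hne
    obtain ⟨n, hn⟩ := exists_nat_one_div_lt (dist_pos.2 hne)
    exact absurd (mem_iInter.1 hq n z z' hz) (not_lt.2 hn.le)
  have hqsurj : Function.Surjective q.1 := by
    intro x
    have hcl : IsClosed (range q.1) := (isCompact_range q.1.continuous).isClosed
    rw [← mem_range, ← hcl.closure_eq, Metric.mem_closure_iff]
    intro ε hε
    obtain ⟨_, ⟨h₀, rfl⟩, hd⟩ := Metric.mem_closure_iff.1 q.2 ε hε
    obtain ⟨z, rfl⟩ := hsurj x
    refine ⟨_, mem_range_self (h₀.symm z), ?_⟩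
    have := (ContinuousMap.dist_apply_le_dist (h₀.symm z)).trans_lt hd
    rw [dist_comm]
    simpa using this
  exact ⟨Continuous.homeoOfEquivCompactToT2 (f := Equiv.ofBijective q.1 ⟨hinj, hqsurj⟩)
    q.1.continuous⟩

/-- A form of **Moore's theorem** for decompositions of the square into convex sets. -/
theorem ConvexFibers.exists_homeomorph_range {X : Type*} [MetricSpace X] {π : C(I × I, X)}
    (hπ : ConvexFibers π) : Nonempty ((I × I) ≃ₜ range π) := by
  obtain ⟨ρ, hρ, hshrink⟩ := hπ.exists_shrinkable
  rw [← hρ]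
  have : CompactSpace (range ρ) := isCompact_iff_compactSpace.1 (isCompact_range ρ.continuous)
  refine exists_homeomorph_of_shrinkable (ρ := ⟨rangeFactorization ρ, by fun_prop⟩)
    rangeFactorization_surjective fun ε hε => ?_
  obtain ⟨h, h1, h2⟩ := hshrink ε hε
  exact ⟨h, h1, fun p q hpq => h2 p q (congrArg Subtype.val hpq)⟩

theorem exists_isEmbedding_square : ∃ j : I × I → EuclideanSpace ℝ (Fin 2), IsEmbedding j := by
  refine ⟨fun p => !₂[(p.1 : ℝ), (p.2 : ℝ)], ?_⟩
  refine (Continuous.isClosedEmbedding (by fun_prop) ?_).isEmbedding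
  intro p q h
  have h0 := congrArg (fun v : EuclideanSpace ℝ (Fin 2) => v 0) h
  have h1 := congrArg (fun v : EuclideanSpace ℝ (Fin 2) => v 1) h
  exact Prod.ext (Subtype.ext (by simpa using h0)) (Subtype.ext (by simpa using h1))

/-- The quotient of the square by a closed equivalence relation with convex classes, trivial
on the boundary, embeds in the plane. -/
theorem exists_continuous_map_plane (T : Setoid (I × I)) (hT : ConvexClasses T)
    (hcl : IsClosed {q : (I × I) × (I × I) | T q.1 q.2})
    (hbd : ∀ p q, T p q → (p.1 = 0 ∨ p.1 = 1 ∨ p.2 = 0 ∨ p.2 = 1) → p = q) :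
    ∃ f : C(I × I, EuclideanSpace ℝ (Fin 2)), ∀ p q, f p = f q ↔ T p q := by
  obtain ⟨φ, hφ⟩ := exists_continuous_kernel_eq T hcl
  let : MetricSpace (ℕ → ℝ) := TopologicalSpace.metrizableSpaceMetric _
  have hker : Setoid.ker φ = T := Setoid.ext fun p q => hφ p q
  have hπ : ConvexFibers φ := ⟨hker ▸ hT, fun p q h => hbd p q ((hφ p q).1 h)⟩
  obtain ⟨e⟩ := hπ.exists_homeomorph_range
  obtain ⟨j, hj⟩ := exists_isEmbedding_square
  refine ⟨⟨fun p => j (e.symm ⟨φ p, mem_range_self p⟩),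
    hj.continuous.comp (e.symm.continuous.comp (by fun_prop))⟩, fun p q => ?_⟩
  rw [← hφ]
  change j _ = j _ ↔ _
  rw [hj.injective.eq_iff, e.symm.injective.eq_iff, Subtype.mk.injEq]

/-- The kernel relation of a proper map out of a Hausdorff space is closed. -/
theorem IsProperMap.isClosed_ker {X Y : Type*} [TopologicalSpace X] [T2Space X]
    [TopologicalSpace Y] {f : X → Y} (hf : IsProperMap f) :
    IsClosed {q : X × X | f q.1 = f q.2} := by
  have hgraph : IsClosed (Prod.map id f '' diagonal X) :=
    (isProperMap_id.prodMap hf).isClosedMap _ isClosed_diagonal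
  convert hgraph.preimage (continuous_id.prodMap hf.continuous) using 1
  ext ⟨x, y⟩
  constructor
  · intro h
    exact ⟨(x, x), rfl, Prod.ext rfl h⟩
  · rintro ⟨⟨a, b⟩, hab, heq⟩
    obtain rfl : a = b := hab
    obtain rfl : a = x := congrArg Prod.fst heq
    exact congrArg Prod.snd heq

/-- The relation induced on the unit square by the classes of a decomposition that meet a set
saturated for it, all other points being singletons. -/
def squareSetoid {E : Type*} (S : Setoid E) (φ : I × I → E) (K : Set E)
    (hK : ∀ x y, S x y → x ∈ K → y ∈ K) : Setoid (I × I) where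
  r z w := z = w ∨ S (φ z) (φ w) ∧ φ z ∈ K
  iseqv := by
    refine ⟨fun z => Or.inl rfl, ?_, ?_⟩
    · rintro z w (rfl | ⟨h, hz⟩)
      · exact Or.inl rfl
      · exact Or.inr ⟨S.symm h, hK _ _ h hz⟩
    · rintro z w v (rfl | ⟨h, hz⟩) (rfl | ⟨h', hw⟩)
      · exact Or.inl rfl
      · exact Or.inr ⟨h', hw⟩
      · exact Or.inr ⟨h, hz⟩
      · exact Or.inr ⟨S.trans h h', hz⟩

theorem exists_linear_parametrization {E : Type*} [NormedAddCommGroup E] [NormedSpace ℝ E]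
    [FiniteDimensional ℝ E] {p : Fin 3 → E} (hp : AffineIndependent ℝ p) :
    ∃ (A : ℝ × ℝ →L[ℝ] E) (L : E →L[ℝ] ℝ × ℝ), (∀ v, L (A v) = v) ∧
      ∀ x ∈ convexHull ℝ (range p), ∃ v, x = p 0 + A v := by
  have hli := (affineIndependent_iff_linearIndependent_vsub ℝ p 0).1 hp
  have hpair : LinearIndependent ℝ ![p 1 - p 0, p 2 - p 0] := by
    have := hli.comp (fun i : Fin 2 => ⟨i.succ, Fin.succ_ne_zero i⟩)
      (fun i j h => Fin.succ_injective _ (congrArg Subtype.val h))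
    have heq : ![p 1 - p 0, p 2 - p 0] = fun i : Fin 2 => p i.succ - p 0 := by
      ext1 i
      fin_cases i <;> rfl
    rw [heq]
    exact this
  let B : ℝ × ℝ →ₗ[ℝ] E := (LinearMap.toSpanSingleton ℝ E (p 1 - p 0)).coprod
    (LinearMap.toSpanSingleton ℝ E (p 2 - p 0))
  have hB : ∀ v, B v = v.1 • (p 1 - p 0) + v.2 • (p 2 - p 0) := fun v => rfl
  have hker : LinearMap.ker B = ⊥ := by
    rw [LinearMap.ker_eq_bot']
    intro v hv
    rw [hB] at hv
    obtain ⟨h1, h2⟩ := LinearIndependent.pair_iff.1 hpair _ _ hv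
    exact Prod.ext h1 h2
  obtain ⟨C, hC⟩ := B.exists_leftInverse_of_injective hker
  refine ⟨B.toContinuousLinearMap, C.toContinuousLinearMap, fun v => ?_, fun x hx => ?_⟩
  · exact LinearMap.congr_fun hC v
  · have hconv : Convex ℝ (range fun v => p 0 + B v) := by
      have : (range fun v => p 0 + B v) = (fun y => p 0 + y) '' (LinearMap.range B : Set E) := by
        ext y
        simp only [mem_range, mem_image, SetLike.mem_coe, LinearMap.mem_range, exists_exists_eq_and]
      rw [this]
      exact (LinearMap.range B).convex.translate _
    have hsub : range p ⊆ range fun v => p 0 + B v := by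
      rintro _ ⟨i, rfl⟩
      fin_cases i
      · exact ⟨0, by simp⟩
      · exact ⟨(1, 0), by simp [hB]⟩
      · exact ⟨(0, 1), by simp [hB]⟩
    obtain ⟨v, hv⟩ := convexHull_min hsub hconv hx
    exact ⟨v, hv.symm⟩

/-- A compact set of an upper semicontinuous convex decomposition that lies in a plane has
planar image. -/
theorem exists_isEmbedding_image_of_subset_plane {E : Type*} [NormedAddCommGroup E]
    [NormedSpace ℝ E] (S : Setoid E) (hconvex : ∀ x, Convex ℝ {y | S x y})
    (hproper : IsProperMap (Quotient.mk S)) {D : Set E} (hD : IsCompact D) (c : E)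
    (A : ℝ × ℝ →L[ℝ] E) (L : E →L[ℝ] ℝ × ℝ) (hLA : ∀ v, L (A v) = v)
    (hDA : ∀ x ∈ D, ∃ v, x = c + A v) :
    ∃ g : (Quotient.mk S '' D : Set (Quotient S)) → EuclideanSpace ℝ (Fin 2),
      IsEmbedding g := by
  let K : Set E := Quotient.mk S ⁻¹' (Quotient.mk S '' D)
  have hKcpt : IsCompact K := hproper.isCompact_preimage (hD.image hproper.continuous)
  have hDK : D ⊆ K := subset_preimage_image _ _
  have hSmk : ∀ {x y}, S x y ↔ Quotient.mk S x = Quotient.mk S y := Quotient.eq.symm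
  have hK : ∀ x y, S x y → x ∈ K → y ∈ K := by
    intro x y h hx
    rw [mem_preimage] at hx ⊢
    rwa [← hSmk.1 h]
  obtain ⟨R, hR⟩ := (hKcpt.image (f := fun x => L (x - c)) (by fun_prop)).isBounded.exists_norm_le
  let M : ℝ := 2 * |R| + 1
  have hM : 0 < M := by positivity
  have hbound : ∀ x ∈ K, ‖L (x - c)‖ < M / 2 := by
    intro x hx
    have h1 := hR _ (mem_image_of_mem _ hx)
    have h2 := le_abs_self R
    simp only [M]
    linarith
  let φ : I × I → E := fun z => c + A (((z.1 : ℝ) - 1 / 2) * M, ((z.2 : ℝ) - 1 / 2) * M)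
  have hφ : Continuous φ := by fun_prop
  have hLφ : ∀ z, L (φ z - c) = (((z.1 : ℝ) - 1 / 2) * M, ((z.2 : ℝ) - 1 / 2) * M) := by
    intro z
    simp only [φ, add_sub_cancel_left, hLA]
  let T := squareSetoid S φ K hK
  have hT : ∀ {z w}, T z w ↔ z = w ∨ S (φ z) (φ w) ∧ φ z ∈ K := Iff.rfl
  have hconv : ConvexClasses T := by
    rintro z w r (rfl | ⟨h, hz⟩) t ht0 ht1 h1 h2
    · refine Or.inl (Prod.ext (Subtype.ext ?_) (Subtype.ext ?_))
      · rw [h1]; ring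
      · rw [h2]; ring
    · refine Or.inr ⟨?_, hz⟩
      have hseg := hconvex (φ z) (S.refl _) h (sub_nonneg.2 ht1) ht0 (by ring)
      have hv : (((r.1 : ℝ) - 1 / 2) * M, ((r.2 : ℝ) - 1 / 2) * M) =
          (1 - t) • (((z.1 : ℝ) - 1 / 2) * M, ((z.2 : ℝ) - 1 / 2) * M) +
          t • (((w.1 : ℝ) - 1 / 2) * M, ((w.2 : ℝ) - 1 / 2) * M) := by
        ext
        · simp [h1]; ring
        · simp [h2]; ring
      have hr : φ r = (1 - t) • φ z + t • φ w := by
        simp only [φ, hv, map_add, map_smul]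
        module
      rw [hr]
      exact hseg
  have hcl : IsClosed {q : (I × I) × (I × I) | T q.1 q.2} := by
    have h1 : IsClosed {q : (I × I) × (I × I) | S (φ q.1) (φ q.2)} := by
      simp only [hSmk]
      exact hproper.isClosed_ker.preimage (f := fun q : (I × I) × (I × I) => (φ q.1, φ q.2))
        (by fun_prop)
    have h2 : IsClosed {q : (I × I) × (I × I) | φ q.1 ∈ K} :=
      hKcpt.isClosed.preimage (by fun_prop)
    exact (isClosed_diagonal (X := I × I)).union (h1.inter h2)
  have hbd : ∀ z w, T z w → (z.1 = 0 ∨ z.1 = 1 ∨ z.2 = 0 ∨ z.2 = 1) → z = w := by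
    rintro z w (h | ⟨-, hz⟩) hside
    · exact h
    exfalso
    have hlt := hbound _ hz
    rw [hLφ, Prod.norm_def, max_lt_iff, Real.norm_eq_abs, Real.norm_eq_abs, abs_lt, abs_lt] at hlt
    obtain ⟨⟨h1, h2⟩, h3, h4⟩ := hlt
    rcases hside with h | h | h | h <;> simp only [h, Icc.coe_zero, Icc.coe_one] at h1 h2 h3 h4 <;>
      linarith
  obtain ⟨f, hf⟩ := exists_continuous_map_plane T hconv hcl hbd
  let ψ : E → I × I := fun x => (projIcc 0 1 zero_le_one ((L (x - c)).1 / M + 1 / 2),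
    projIcc 0 1 zero_le_one ((L (x - c)).2 / M + 1 / 2))
  have hψ : Continuous ψ := by
    have h : Continuous (projIcc (0 : ℝ) 1 zero_le_one) := continuous_projIcc
    exact (h.comp (by fun_prop)).prodMk (h.comp (by fun_prop))
  have hφψ : ∀ x ∈ D, φ (ψ x) = x := by
    intro x hx
    obtain ⟨v, rfl⟩ := hDA x hx
    have hlt := hbound _ (hDK hx)
    rw [add_sub_cancel_left, hLA, Prod.norm_def, max_lt_iff, Real.norm_eq_abs, Real.norm_eq_abs,
      abs_lt, abs_lt] at hlt
    obtain ⟨⟨h1, h2⟩, h3, h4⟩ := hlt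
    have hmem : ∀ a : ℝ, -(M / 2) < a → a < M / 2 →
        ((projIcc (0 : ℝ) 1 zero_le_one (a / M + 1 / 2) : ℝ) - 1 / 2) * M = a := by
      intro a ha ha'
      have hl : 0 ≤ a / M + 1 / 2 := by
        have : -(1 / 2) ≤ a / M := by rw [le_div_iff₀ hM]; linarith
        linarith
      have hu : a / M + 1 / 2 ≤ 1 := by
        have : a / M ≤ 1 / 2 := by rw [div_le_iff₀ hM]; linarith
        linarith
      rw [projIcc_of_mem zero_le_one ⟨hl, hu⟩]
      field_simp
      ring
    simp only [φ, ψ, add_sub_cancel_left, hLA, hmem _ h1 h2, hmem _ h3 h4]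
  have hfψ : ∀ x ∈ D, ∀ y ∈ D, f (ψ x) = f (ψ y) ↔ Quotient.mk S x = Quotient.mk S y := by
    intro x hx y hy
    rw [hf, hT, hφψ x hx, hφψ y hy, ← hSmk]
    constructor
    · rintro (h | h)
      · rw [← hφψ x hx, ← hφψ y hy, h]
      · exact h.1
    · exact fun h => Or.inr ⟨h, hDK hx⟩
  have hquot : IsQuotientMap (D.imageFactorization (Quotient.mk S)) := by
    refine IsClosedMap.isQuotientMap ?_ ?_ imageFactorization_surjective
    · exact (hproper.isClosedMap.comp hD.isClosed.isClosedMap_subtype_val).subtype_mk _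
    · exact (hproper.continuous.comp continuous_subtype_val).subtype_mk _
  have : CompactSpace D := isCompact_iff_compactSpace.1 hD
  have : CompactSpace (Quotient.mk S '' D) :=
    isCompact_iff_compactSpace.1 (hD.image hproper.continuous)
  choose s hsD hs using fun y : (Quotient.mk S '' D : Set (Quotient S)) => y.2
  let g : (Quotient.mk S '' D : Set (Quotient S)) → EuclideanSpace ℝ (Fin 2) :=
    fun y => f (ψ (s y))
  have hg : Continuous g := by
    rw [hquot.continuous_iff]
    have : g ∘ D.imageFactorization (Quotient.mk S) = fun x : D => f (ψ x) := by
      funext x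
      exact (hfψ _ (hsD _) _ x.2).2 (hs _)
    rw [this]
    fun_prop
  have hinj : Function.Injective g := by
    intro y y' h
    apply Subtype.ext
    rw [← hs y, ← hs y']
    exact (hfψ _ (hsD _) _ (hsD _)).1 h
  exact ⟨g, (hg.isClosedEmbedding hinj).isEmbedding⟩

end

/-- If `G` is an upper semicontinuous decomposition of `ℝⁿ` into compact convex
sets with quotient map `π`, and `σ ⊆ ℝⁿ` is a 2-simplex (the convex hull of an affinely
independent set of three points), then `π(σ)` topologically embeds into `ℝ²`. -/
theorem convex_decomposition_image_of_two_simplex_embeds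
    (n : ℕ) (S : Setoid (EuclideanSpace ℝ (Fin n)))
    (hcompact : ∀ x, IsCompact {y | S x y})
    (hconvex : ∀ x, Convex ℝ {y | S x y})
    (hproper : IsProperMap (Quotient.mk S))
    (p : Fin 3 → EuclideanSpace ℝ (Fin n)) (hp : AffineIndependent ℝ p) :
    ∃ g : (Quotient.mk S '' convexHull ℝ (Set.range p) : Set (Quotient S)) →
        EuclideanSpace ℝ (Fin 2),
      Topology.IsEmbedding g := by
  obtain ⟨A, L, hLA, hD⟩ := exists_linear_parametrization hp
  exact exists_isEmbedding_image_of_subset_plane S hconvex hproper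
    ((Set.finite_range p).isCompact_convexHull ℝ) (p 0) A L hLA hD
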